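/- arXiv:1311.3240 — 2 statements merged into one kernel-verified Lean document; each statement's English description precedes it below -/
import Mathlib

section
/- Let t ≥ 2 be an integer and let n₁,…,n_t be positive integers. Then mass(𝒯ₜ) · |ℱₜ| ≥ |𝒯ₜ| · mass(ℱₜ). Equivalently, for the random forest F^{(𝐧)} on {1,…,t} chosen with probability proportional to mass, the probability that F^{(𝐧)} is connected is at least the probability that a uniformly random forest on {1,…,t} is connected: mass(𝒯ₜ)/mass(ℱₜ) ≥ |𝒯ₜ|/|ℱₜ|. -/
/-- The degree of vertex `v` in `G` (the number of neighbours of `v`). -/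
noncomputable def deg {t : ℕ} (G : SimpleGraph (Fin t)) (v : Fin t) : ℕ :=
  (G.neighborSet v).ncard

/-- The mass of a graph `F` with respect to weights `w`: `∏ i, w i ^ d_F(i)`. -/
noncomputable def mass {t : ℕ} (w : Fin t → ℕ) (F : SimpleGraph (Fin t)) : ℝ :=
  ∏ i, (w i : ℝ) ^ deg F i

/-- The total mass of a set of graphs. -/
noncomputable def massSet {t : ℕ} (w : Fin t → ℕ) (S : Set (SimpleGraph (Fin t))) : ℝ :=
  ∑ᶠ F ∈ S, mass w F

section SubsetSums

variable {V : Type*}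

lemma sq_card_le_sum_mul_sum_inv (y : V → ℝ) (M : Finset V) (hy : ∀ j ∈ M, 0 < y j) :
    (M.card : ℝ) ^ 2 ≤ (∑ j ∈ M, y j) * ∑ j ∈ M, 1 / y j := by
  have := Finset.sum_sq_le_sum_mul_sum_of_sq_le_mul M (r := fun _ ↦ (1 : ℝ)) (f := y)
    (g := fun j ↦ 1 / y j) (fun j hj ↦ (hy j hj).le) (fun j hj ↦ by have := hy j hj; positivity)
    (fun j hj ↦ by have := hy j hj; rw [mul_one_div_cancel this.ne', one_pow])
  simpa using this

variable [DecidableEq V]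

lemma sum_powerset_compl (M : Finset V) (f : Finset V → ℝ) :
    ∑ D ∈ M.powerset, f D = ∑ A ∈ M.powerset, f (M \ A) := by
  refine Finset.sum_nbij' (M \ ·) (M \ ·) ?_ ?_ ?_ ?_ ?_
  · simp
  · simp
  · intro D hD
    simpa using Finset.mem_powerset.1 hD
  · intro D hD
    simpa using Finset.mem_powerset.1 hD
  · intro D hD
    simp [Finset.inter_eq_right.2 (Finset.mem_powerset.1 hD)]

lemma sum_powerset_filter_mem {M : Finset V} {j : V} (hj : j ∈ M) (g : Finset V → ℝ) :
    ∑ D ∈ M.powerset with j ∈ D, g D = ∑ D ∈ (M.erase j).powerset, g (insert j D) := by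
  refine Finset.sum_nbij' (·.erase j) (insert j ·) ?_ ?_ ?_ ?_ ?_
  · intro D hD
    simp only [Finset.mem_filter, Finset.mem_powerset] at hD ⊢
    exact Finset.erase_subset_erase _ hD.1
  · intro D hD
    simp only [Finset.mem_filter, Finset.mem_powerset] at hD ⊢
    exact ⟨Finset.insert_subset hj (hD.trans (Finset.erase_subset _ _)),
      Finset.mem_insert_self _ _⟩
  · intro D hD
    exact Finset.insert_erase (Finset.mem_filter.1 hD).2
  · intro D hD
    exact Finset.erase_insert fun h ↦ by simpa using Finset.mem_powerset.1 hD h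
  · intro D hD
    rw [Finset.insert_erase (Finset.mem_filter.1 hD).2]

lemma sum_powerset_sum_mem (M : Finset V) (f : V → Finset V → ℝ) :
    ∑ D ∈ M.powerset, ∑ j ∈ D, f j D = ∑ j ∈ M, ∑ D ∈ M.powerset with j ∈ D, f j D := by
  refine Finset.sum_comm' fun D j ↦ ?_
  simp only [Finset.mem_powerset, Finset.mem_filter]
  exact ⟨fun h ↦ ⟨h, h.1 h.2⟩, fun h ↦ h.1⟩

lemma sum_powerset_sum_insert (M : Finset V) (f : V → Finset V → ℝ) :
    ∑ D ∈ M.powerset, ∑ j ∈ D, f j D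
      = ∑ j ∈ M, ∑ D ∈ (M.erase j).powerset, f j (insert j D) := by
  rw [sum_powerset_sum_mem]
  exact Finset.sum_congr rfl fun j hj ↦ sum_powerset_filter_mem hj _

lemma sum_powerset_sum_sdiff (M : Finset V) (f : V → Finset V → ℝ) :
    ∑ D ∈ M.powerset, ∑ j ∈ M \ D, f j D = ∑ j ∈ M, ∑ D ∈ (M.erase j).powerset, f j D := by
  refine Finset.sum_comm' fun D j ↦ ?_
  simp only [Finset.mem_powerset, Finset.mem_sdiff, Finset.subset_erase]
  tauto

/-- A finite difference of order `#M` kills powers of exponent less than `#M`. -/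
lemma alternating_sum_pow_eq_zero (y : V → ℝ) (M : Finset V) :
    ∀ k < M.card, ∀ x : ℝ,
      ∑ A ∈ M.powerset, (-1 : ℝ) ^ A.card * (x + ∑ j ∈ A, y j) ^ k = 0 := by
  induction M using Finset.induction_on with
  | empty => simp
  | insert i M hi ih =>
    intro k hk x
    rw [Finset.card_insert_of_notMem hi] at hk
    rw [Finset.sum_powerset_insert hi]
    have key : ∀ A ∈ M.powerset,
        (-1 : ℝ) ^ (insert i A).card * (x + ∑ j ∈ insert i A, y j) ^ k
          = -((-1 : ℝ) ^ A.card * (x + ∑ j ∈ A, y j) ^ k)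
            - ∑ l ∈ Finset.range k, y i ^ (k - l) * k.choose l *
                ((-1 : ℝ) ^ A.card * (x + ∑ j ∈ A, y j) ^ l) := by
      intro A hA
      have hiA : i ∉ A := fun h ↦ hi (Finset.mem_powerset.1 hA h)
      rw [Finset.card_insert_of_notMem hiA, Finset.sum_insert hiA,
        show x + (y i + ∑ j ∈ A, y j) = (x + ∑ j ∈ A, y j) + y i by ring,
        add_pow, Finset.sum_range_succ, mul_add, Finset.mul_sum]
      have : ∀ l ∈ Finset.range k,
          (-1 : ℝ) ^ (A.card + 1) * ((x + ∑ j ∈ A, y j) ^ l * y i ^ (k - l) * k.choose l)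
            = -(y i ^ (k - l) * k.choose l * ((-1 : ℝ) ^ A.card * (x + ∑ j ∈ A, y j) ^ l)) := by
        intro l _
        ring
      rw [Finset.sum_congr rfl this, Finset.sum_neg_distrib]
      simp
      ring
    rw [Finset.sum_congr rfl key, Finset.sum_sub_distrib, Finset.sum_neg_distrib,
      Finset.sum_comm]
    have : ∀ l ∈ Finset.range k, ∑ A ∈ M.powerset, y i ^ (k - l) * k.choose l *
                ((-1 : ℝ) ^ A.card * (x + ∑ j ∈ A, y j) ^ l) = 0 := by
      intro l hl
      rw [← Finset.mul_sum, ih l (by have := Finset.mem_range.1 hl; omega), mul_zero]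
    rw [Finset.sum_congr rfl this]
    simp

/-- Hurwitz's generalisation of Abel's binomial theorem. -/
lemma hurwitz_sum (y : V → ℝ) (M : Finset V) (hy : ∀ j ∈ M, 0 < y j) {x : ℝ} (hx : 0 < x)
    (z : ℝ) :
    ∑ D ∈ M.powerset, x * (x + ∑ j ∈ M \ D, y j) ^ (((M \ D).card : ℤ) - 1)
        * (z + ∑ j ∈ D, y j) ^ D.card
      = (x + z + ∑ j ∈ M, y j) ^ M.card := by
  set s := x + z + ∑ j ∈ M, y j with hs
  have hpos : ∀ A ⊆ M, 0 < x + ∑ j ∈ A, y j := fun A hA ↦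
    add_pos_of_pos_of_nonneg hx (Finset.sum_nonneg fun j hj ↦ (hy j (hA hj)).le)
  rw [sum_powerset_compl]
  have expand : ∀ A ∈ M.powerset,
      x * (x + ∑ j ∈ M \ (M \ A), y j) ^ (((M \ (M \ A)).card : ℤ) - 1)
        * (z + ∑ j ∈ M \ A, y j) ^ (M \ A).card
      = ∑ K ∈ (M \ A).powerset, x * (x + ∑ j ∈ A, y j) ^ ((A.card : ℤ) - 1) *
          (s ^ K.card * (-(x + ∑ j ∈ A, y j)) ^ ((M \ A).card - K.card)) := by
    intro A hA
    have hA' := Finset.mem_powerset.1 hA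
    rw [Finset.sdiff_sdiff_eq_self hA', ← Finset.mul_sum, Finset.sum_pow_mul_eq_add_pow]
    congr 2
    rw [hs, ← Finset.sum_sdiff hA']
    ring
  rw [Finset.sum_congr rfl expand,
    Finset.sum_comm' (t' := M.powerset) (s' := fun K ↦ (M \ K).powerset) (by
      intro A K
      simp only [Finset.mem_powerset, Finset.subset_sdiff]
      rw [disjoint_comm]
      tauto)]
  rw [Finset.sum_eq_single_of_mem M (Finset.mem_powerset_self M)]
  · simp [hx.ne']
  · intro K hK hKM
    have hK' := Finset.mem_powerset.1 hK
    have hlt : 0 < (M \ K).card := by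
      rw [Finset.card_pos, Finset.sdiff_nonempty]
      exact fun h ↦ hKM (hK'.antisymm h)
    have key : ∀ A ∈ (M \ K).powerset,
        x * (x + ∑ j ∈ A, y j) ^ ((A.card : ℤ) - 1) *
          (s ^ K.card * (-(x + ∑ j ∈ A, y j)) ^ ((M \ A).card - K.card))
        = x * s ^ K.card * (-1) ^ (M \ K).card * ((-1 : ℝ) ^ A.card *
          (x + ∑ j ∈ A, y j) ^ ((M \ K).card - 1)) := by
      intro A hA
      have hA' := Finset.mem_powerset.1 hA
      have hAM := hA'.trans Finset.sdiff_subset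
      have hX := hpos A hAM
      set X := x + ∑ j ∈ A, y j
      obtain ⟨e, he⟩ : ∃ e, (M \ K).card = A.card + e :=
        ⟨_, (Nat.add_sub_of_le (Finset.card_le_card hA')).symm⟩
      have h1 : (M \ A).card - K.card = e := by
        rw [Finset.card_sdiff_of_subset hAM]
        rw [Finset.card_sdiff_of_subset hK'] at he
        omega
      have h2 : X ^ ((A.card : ℤ) - 1) * X ^ e = X ^ ((M \ K).card - 1) := by
        rw [← zpow_natCast, ← zpow_natCast, ← zpow_add₀ hX.ne']
        congr 1
        omega
      have h3 : (-1 : ℝ) ^ (M \ K).card * (-1) ^ A.card = (-1) ^ e := by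
        rw [he, pow_add, mul_right_comm, ← mul_pow]
        simp
      rw [h1, neg_pow, ← h2, ← h3]
      ring
    rw [Finset.sum_congr rfl key, ← Finset.mul_sum,
      alternating_sum_pow_eq_zero y _ _ (by omega), mul_zero]

/-- The symmetric form of Hurwitz's identity. -/
lemma hurwitz_sum_symm (y : V → ℝ) (M : Finset V) (hy : ∀ j ∈ M, 0 < y j) {x z : ℝ}
    (hx : 0 < x) (hz : 0 < z) :
    ∑ D ∈ M.powerset, (x + ∑ j ∈ M \ D, y j) ^ (((M \ D).card : ℤ) - 1)
        * (z + ∑ j ∈ D, y j) ^ ((D.card : ℤ) - 1)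
      = (x + z + ∑ j ∈ M, y j) ^ ((M.card : ℤ) - 1) * (1 / x + 1 / z) := by
  have h1 := hurwitz_sum y M hy hx z
  have h2 := hurwitz_sum y M hy hz x
  rw [sum_powerset_compl] at h2
  have hY : 0 ≤ ∑ j ∈ M, y j := Finset.sum_nonneg fun j hj ↦ (hy j hj).le
  have hs : 0 < x + z + ∑ j ∈ M, y j := by positivity
  rw [show z + x = x + z by ring] at h2
  set s := x + z + ∑ j ∈ M, y j with hsdef
  have hmul : s * ∑ D ∈ M.powerset, (x + ∑ j ∈ M \ D, y j) ^ (((M \ D).card : ℤ) - 1)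
        * (z + ∑ j ∈ D, y j) ^ ((D.card : ℤ) - 1) = s ^ M.card * (1 / x + 1 / z) := by
    have hsplit := congrArg₂ (fun a b ↦ a / x + b / z) h1 h2
    rw [mul_add, mul_one_div, mul_one_div, ← hsplit, Finset.sum_div, Finset.sum_div,
      ← Finset.sum_add_distrib, Finset.mul_sum]
    refine Finset.sum_congr rfl fun D hD ↦ ?_
    have hD' := Finset.mem_powerset.1 hD
    have hX : 0 < x + ∑ j ∈ M \ D, y j := add_pos_of_pos_of_nonneg hx
      (Finset.sum_nonneg fun j hj ↦ (hy j (Finset.sdiff_subset hj)).le)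
    have hZ : 0 < z + ∑ j ∈ D, y j := add_pos_of_pos_of_nonneg hz
      (Finset.sum_nonneg fun j hj ↦ (hy j (hD' hj)).le)
    have hXZ : s = (x + ∑ j ∈ M \ D, y j) + (z + ∑ j ∈ D, y j) := by
      rw [hsdef, ← Finset.sum_sdiff hD']
      ring
    rw [Finset.sdiff_sdiff_eq_self hD', hXZ]
    set X := x + ∑ j ∈ M \ D, y j
    set Z := z + ∑ j ∈ D, y j
    rw [zpow_sub_one₀ hX.ne', zpow_sub_one₀ hZ.ne', zpow_natCast, zpow_natCast]
    field_simp
    ring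
  rw [zpow_sub_one₀ hs.ne', zpow_natCast, mul_right_comm, ← hmul]
  field_simp

/-- The degenerate case of Hurwitz's identity. The term `D = ∅` contributes `0`. -/
lemma hurwitz_sum_unrooted (y : V → ℝ) (M : Finset V) (hy : ∀ j ∈ M, 0 < y j) {x : ℝ}
    (hx : 0 < x) :
    ∑ D ∈ M.powerset, (x + ∑ j ∈ M \ D, y j) ^ (((M \ D).card : ℤ) - 1)
        * (∑ j ∈ D, y j) ^ ((D.card : ℤ) - 1)
      = (x + ∑ j ∈ M, y j) ^ ((M.card : ℤ) - 1) / x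
        + (M.card - 1) * (x + ∑ j ∈ M, y j) ^ ((M.card : ℤ) - 2) := by
  have hY : 0 ≤ ∑ j ∈ M, y j := Finset.sum_nonneg fun j hj ↦ (hy j hj).le
  have hs : 0 < x + ∑ j ∈ M, y j := by positivity
  have hDpos : ∀ D ⊆ M, D.Nonempty → 0 < ∑ j ∈ D, y j := fun D hD hne ↦
    Finset.sum_pos (fun j hj ↦ hy j (hD hj)) hne
  have h1 : ∑ D ∈ M.powerset, (x + ∑ j ∈ M \ D, y j) ^ (((M \ D).card : ℤ) - 1)
      * ((∑ j ∈ D, y j) * (∑ j ∈ D, y j) ^ ((D.card : ℤ) - 1))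
      = (x + ∑ j ∈ M, y j) ^ M.card / x - (x + ∑ j ∈ M, y j) ^ ((M.card : ℤ) - 1) := by
    have h := hurwitz_sum y M hy hx 0
    rw [add_zero] at h
    rw [← h, ← Finset.add_sum_erase _ _ (Finset.empty_mem_powerset M),
      ← Finset.add_sum_erase _ _ (Finset.empty_mem_powerset M), add_div, Finset.sum_div]
    have : ∀ D ∈ M.powerset.erase ∅, (x + ∑ j ∈ M \ D, y j) ^ (((M \ D).card : ℤ) - 1)
        * ((∑ j ∈ D, y j) * (∑ j ∈ D, y j) ^ ((D.card : ℤ) - 1))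
        = x * (x + ∑ j ∈ M \ D, y j) ^ (((M \ D).card : ℤ) - 1)
          * (0 + ∑ j ∈ D, y j) ^ D.card / x := by
      intro D hD
      rw [Finset.mem_erase, Finset.mem_powerset] at hD
      have hD0 := hDpos D hD.2 (Finset.nonempty_iff_ne_empty.2 hD.1)
      rw [zpow_sub_one₀ hD0.ne', zpow_natCast, zero_add]
      field_simp
    rw [Finset.sum_congr rfl this]
    simp
    field_simp
  have h2 : ∑ D ∈ M.powerset, (x + ∑ j ∈ M \ D, y j) ^ (M \ D).card
      * (∑ j ∈ D, y j) ^ ((D.card : ℤ) - 1)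
      = M.card * (x + ∑ j ∈ M, y j) ^ ((M.card : ℤ) - 1) := by
    have split : ∀ D ∈ M.powerset, (x + ∑ j ∈ M \ D, y j) ^ (M \ D).card
        * (∑ j ∈ D, y j) ^ ((D.card : ℤ) - 1)
        = ∑ i ∈ D, (x + ∑ j ∈ M \ D, y j) ^ (M \ D).card
          * (y i * (∑ j ∈ D, y j) ^ ((D.card : ℤ) - 2)) := by
      intro D hD
      rw [← Finset.mul_sum, ← Finset.sum_mul]
      rcases D.eq_empty_or_nonempty with rfl | hne
      · simp
      · have hD0 := hDpos D (Finset.mem_powerset.1 hD) hne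
        rw [show (D.card : ℤ) - 1 = (D.card - 2) + 1 by ring, zpow_add_one₀ hD0.ne',
          mul_comm (∑ j ∈ D, y j)]
    rw [Finset.sum_congr rfl split, sum_powerset_sum_insert, ← nsmul_eq_mul]
    refine Finset.sum_eq_card_nsmul fun i hi ↦ ?_
    have hz := hurwitz_sum y (M.erase i) (fun j hj ↦ hy j (Finset.mem_of_mem_erase hj))
      (hy i hi) x
    rw [sum_powerset_compl] at hz
    have hM : (x + ∑ j ∈ M, y j) ^ ((M.card : ℤ) - 1)
        = (y i + x + ∑ j ∈ M.erase i, y j) ^ (M.erase i).card := by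
      rw [← Finset.add_sum_erase _ _ hi, Finset.card_erase_of_mem hi, ← zpow_natCast,
        Nat.cast_sub (Finset.card_pos.2 ⟨i, hi⟩)]
      simp only [Nat.cast_one]
      congr 1
      ring
    rw [hM, ← hz]
    refine Finset.sum_congr rfl fun D hD ↦ ?_
    have hD' := Finset.mem_powerset.1 hD
    have hiD : i ∉ D := fun h ↦ by simpa using hD' h
    rw [Finset.sdiff_sdiff_eq_self hD', Finset.card_insert_of_notMem hiD,
      Finset.sum_insert hiD, Finset.sdiff_insert, ← Finset.erase_sdiff_comm]
    push_cast
    rw [show (D.card : ℤ) + 1 - 2 = D.card - 1 by ring]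
    ring
  have hmul : (x + ∑ j ∈ M, y j) *
      ∑ D ∈ M.powerset, (x + ∑ j ∈ M \ D, y j) ^ (((M \ D).card : ℤ) - 1)
        * (∑ j ∈ D, y j) ^ ((D.card : ℤ) - 1)
      = (x + ∑ j ∈ M, y j) ^ M.card / x
        + (M.card - 1) * (x + ∑ j ∈ M, y j) ^ ((M.card : ℤ) - 1) := by
    have h3 := congrArg₂ (· + ·) h1 h2
    simp only [← Finset.sum_add_distrib] at h3
    rw [Finset.mul_sum]
    calc _ = _ := ?_
      _ = _ := h3
      _ = _ := by ring
    refine Finset.sum_congr rfl fun D hD ↦ ?_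
    have hD' := Finset.mem_powerset.1 hD
    have hX : 0 < x + ∑ j ∈ M \ D, y j := add_pos_of_pos_of_nonneg hx
      (Finset.sum_nonneg fun j hj ↦ (hy j (Finset.sdiff_subset hj)).le)
    have hsum : x + ∑ j ∈ M, y j = (x + ∑ j ∈ M \ D, y j) + ∑ j ∈ D, y j := by
      rw [← Finset.sum_sdiff hD']
      ring
    rw [hsum, zpow_sub_one₀ hX.ne', zpow_natCast]
    field_simp
    ring
  rw [← mul_right_inj' hs.ne', hmul,
    show (M.card : ℤ) - 2 = (M.card - 1) - 1 by ring, zpow_sub_one₀ hs.ne' (M.card - 1),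
    zpow_sub_one₀ hs.ne', zpow_natCast]
  field_simp

/-- The inequality behind monotonicity: splitting a vertex set into a tree through a fixed vertex
of weight `x` and a further tree, the degree of the fixed vertex is on average at most
what it is in a spanning tree. -/
lemma two_tree_inequality (y : V → ℝ) (M : Finset V) (hy : ∀ j ∈ M, 0 < y j) {x : ℝ}
    (hx : 0 < x) :
    ∑ D ∈ M.powerset, (((M \ D).card : ℝ) - 1)
        * (x + ∑ j ∈ M \ D, y j) ^ (((M \ D).card : ℤ) - 2)
        * (∑ j ∈ D, y j) ^ ((D.card : ℤ) - 1)
      ≤ ∑ D ∈ M.powerset, (D.card : ℝ) * (x + ∑ j ∈ M \ D, y j) ^ (((M \ D).card : ℤ) - 1)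
        * (∑ j ∈ D, y j) ^ ((D.card : ℤ) - 2) := by
  have hY : 0 ≤ ∑ j ∈ M, y j := Finset.sum_nonneg fun j hj ↦ (hy j hj).le
  have hs : 0 < x + ∑ j ∈ M, y j := by positivity
  set s := x + ∑ j ∈ M, y j with hsdef
  have hcard : ∀ i ∈ M, ((M.erase i).card : ℤ) = M.card - 1 := fun i hi ↦ by
    rw [Finset.card_erase_of_mem hi, Nat.cast_sub (Finset.card_pos.2 ⟨i, hi⟩), Nat.cast_one]
  have hcardR : ∀ i ∈ M, ((M.erase i).card : ℝ) = M.card - 1 := fun i hi ↦ by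
    exact_mod_cast hcard i hi
  have hR : ∑ D ∈ M.powerset, (D.card : ℝ)
        * (x + ∑ j ∈ M \ D, y j) ^ (((M \ D).card : ℤ) - 1)
        * (∑ j ∈ D, y j) ^ ((D.card : ℤ) - 2)
      = ∑ i ∈ M, s ^ ((M.card : ℤ) - 2) * (1 / x + 1 / y i) := by
    simp_rw [mul_assoc, ← nsmul_eq_mul, ← Finset.sum_const]
    rw [sum_powerset_sum_insert]
    refine Finset.sum_congr rfl fun i hi ↦ ?_
    have h := hurwitz_sum_symm y (M.erase i) (fun j hj ↦ hy j (Finset.mem_of_mem_erase hj))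
      hx (hy i hi)
    rw [hcard i hi, add_assoc, Finset.add_sum_erase _ _ hi, ← hsdef,
      show (M.card : ℤ) - 1 - 1 = M.card - 2 by ring] at h
    rw [← h]
    refine Finset.sum_congr rfl fun D hD ↦ ?_
    have hiD : i ∉ D := fun h ↦ by simpa using Finset.mem_powerset.1 hD h
    rw [Finset.card_insert_of_notMem hiD,
      Finset.sum_insert hiD, Finset.sdiff_insert, ← Finset.erase_sdiff_comm]
    push_cast
    rw [show (D.card : ℤ) + 1 - 2 = D.card - 1 by ring]
  have hL : ∑ D ∈ M.powerset, ((M \ D).card : ℝ)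
        * (x + ∑ j ∈ M \ D, y j) ^ (((M \ D).card : ℤ) - 2)
        * (∑ j ∈ D, y j) ^ ((D.card : ℤ) - 1)
      = ∑ i ∈ M, (s ^ ((M.card : ℤ) - 2) / (x + y i)
          + (M.card - 2) * s ^ ((M.card : ℤ) - 3)) := by
    simp_rw [mul_assoc, ← nsmul_eq_mul, ← Finset.sum_const]
    rw [sum_powerset_sum_sdiff]
    refine Finset.sum_congr rfl fun i hi ↦ ?_
    have h := hurwitz_sum_unrooted y (M.erase i)
      (fun j hj ↦ hy j (Finset.mem_of_mem_erase hj)) (add_pos hx (hy i hi))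
    rw [hcard i hi, hcardR i hi, add_assoc, Finset.add_sum_erase _ _ hi, ← hsdef,
      show (M.card : ℤ) - 1 - 1 = M.card - 2 by ring,
      show (M.card : ℤ) - 1 - 2 = M.card - 3 by ring,
      show (M.card : ℝ) - 1 - 1 = M.card - 2 by ring] at h
    rw [← h]
    refine Finset.sum_congr rfl fun D hD ↦ ?_
    have hiD : i ∉ D := fun h ↦ by simpa using Finset.mem_powerset.1 hD h
    have hi' : i ∈ M \ D := Finset.mem_sdiff.2 ⟨hi, hiD⟩
    rw [Finset.erase_sdiff_comm, Finset.card_erase_of_mem hi', add_assoc,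
      Finset.add_sum_erase _ _ hi', Nat.cast_sub (Finset.card_pos.2 ⟨i, hi'⟩), Nat.cast_one,
      show ((M \ D).card : ℤ) - 1 - 1 = (M \ D).card - 2 by ring]
  calc _ ≤ ∑ D ∈ M.powerset, ((M \ D).card : ℝ)
        * (x + ∑ j ∈ M \ D, y j) ^ (((M \ D).card : ℤ) - 2)
        * (∑ j ∈ D, y j) ^ ((D.card : ℤ) - 1) := by
        refine Finset.sum_le_sum fun D hD ↦ ?_
        have hX : 0 ≤ ∑ j ∈ M \ D, y j :=
          Finset.sum_nonneg fun j hj ↦ (hy j (Finset.sdiff_subset hj)).le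
        have hZ : 0 ≤ ∑ j ∈ D, y j :=
          Finset.sum_nonneg fun j hj ↦ (hy j (Finset.mem_powerset.1 hD hj)).le
        gcongr
        linarith
    _ = s ^ ((M.card : ℤ) - 2) * ∑ i ∈ M, 1 / (x + y i)
        + M.card * (M.card - 2) * s ^ ((M.card : ℤ) - 3) := by
        rw [hL, Finset.sum_add_distrib, Finset.mul_sum, Finset.sum_const, nsmul_eq_mul]
        simp only [mul_one_div]
        ring
    _ ≤ s ^ ((M.card : ℤ) - 2) * ∑ i ∈ M, 1 / x
        + s ^ ((M.card : ℤ) - 2) * ∑ i ∈ M, 1 / y i := by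
        refine add_le_add ?_ ?_
        · gcongr with i hi
          have := hy i hi
          linarith
        · have hσ : 0 ≤ ∑ i ∈ M, 1 / y i :=
            Finset.sum_nonneg fun j hj ↦ by have := hy j hj; positivity
          have h := sq_card_le_sum_mul_sum_inv y M hy
          rw [show (M.card : ℤ) - 2 = M.card - 3 + 1 by ring, zpow_add_one₀ hs.ne',
            mul_assoc (s ^ _), mul_comm _ (s ^ _)]
          refine mul_le_mul_of_nonneg_left ?_ (by positivity)
          nlinarith [mul_nonneg hx.le hσ]
    _ = _ := by
        rw [hR, ← Finset.mul_sum, Finset.sum_add_distrib, mul_add]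

lemma sum_powerset_powerset (M : Finset V) (g : Finset V → Finset V → ℝ) :
    ∑ C ∈ M.powerset, ∑ D ∈ C.powerset, g C D
      = ∑ E ∈ M.powerset, ∑ D ∈ (M \ E).powerset, g (E ∪ D) D := by
  rw [Finset.sum_sigma', Finset.sum_sigma']
  refine Finset.sum_nbij' (fun p ↦ ⟨p.1 \ p.2, p.2⟩) (fun p ↦ ⟨p.1 ∪ p.2, p.2⟩) ?_ ?_ ?_ ?_ ?_
  · rintro ⟨C, D⟩ h
    simp only [Finset.mem_sigma, Finset.mem_powerset] at h ⊢
    exact ⟨Finset.sdiff_subset.trans h.1,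
      Finset.subset_sdiff.2 ⟨h.2.trans h.1, Finset.disjoint_sdiff⟩⟩
  · rintro ⟨E, D⟩ h
    simp only [Finset.mem_sigma, Finset.mem_powerset, Finset.subset_sdiff] at h ⊢
    exact ⟨Finset.union_subset h.1 h.2.1, Finset.subset_union_right⟩
  · rintro ⟨C, D⟩ h
    simp only [Finset.mem_sigma, Finset.mem_powerset] at h
    simp [Finset.sdiff_union_of_subset h.2]
  · rintro ⟨E, D⟩ h
    simp only [Finset.mem_sigma, Finset.mem_powerset, Finset.subset_sdiff] at h
    simp [Finset.union_sdiff_cancel_right h.2.2.symm]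
  · rintro ⟨C, D⟩ h
    simp only [Finset.mem_sigma, Finset.mem_powerset] at h
    simp [Finset.sdiff_union_of_subset h.2]

lemma sum_mul_of_recursion (y : V → ℝ) {C : Finset V} (K : Finset V → ℝ)
    (hrec : ∀ v ∈ C, K C
      = ∑ D ∈ C.powerset with v ∈ D, (∑ j ∈ D, y j) ^ ((D.card : ℤ) - 2) * K (C \ D))
    (f : V → ℝ) :
    (∑ v ∈ C, f v) * K C = ∑ D ∈ C.powerset,
      (∑ v ∈ D, f v) * ((∑ j ∈ D, y j) ^ ((D.card : ℤ) - 2) * K (C \ D)) := by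
  simp_rw [Finset.sum_mul]
  rw [sum_powerset_sum_mem]
  refine Finset.sum_congr rfl fun v hv ↦ ?_
  rw [← Finset.mul_sum, ← hrec v hv]

/-- If `K` satisfies the recursion of normalised forest masses, then the ratio of forest mass to
tree mass is antitone in the weight `x` of a fixed vertex. -/
lemma antitoneOn_of_recursion (y : V → ℝ) (M : Finset V) (hy : ∀ j ∈ M, 0 < y j)
    (K : Finset V → ℝ) (hK : ∀ C, 0 ≤ K C)
    (hrec : ∀ C ⊆ M, ∀ v ∈ C, K C
      = ∑ D ∈ C.powerset with v ∈ D, (∑ j ∈ D, y j) ^ ((D.card : ℤ) - 2) * K (C \ D)) :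
    AntitoneOn (fun x : ℝ ↦ ∑ C ∈ M.powerset, K C *
      ((x + ∑ j ∈ M \ C, y j) ^ (((M \ C).card : ℤ) - 1)
        * (x + ∑ j ∈ M, y j) ^ (1 - (M.card : ℤ)))) (Set.Ioi 0) := by
  have hpos : ∀ x ∈ Set.Ioi (0 : ℝ), ∀ A ⊆ M, 0 < x + ∑ j ∈ A, y j := fun x hx A hA ↦
    add_pos_of_pos_of_nonneg hx (Finset.sum_nonneg fun j hj ↦ (hy j (hA hj)).le)
  have hder : ∀ x ∈ Set.Ioi (0 : ℝ), HasDerivAt (fun x : ℝ ↦ ∑ C ∈ M.powerset, K C *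
      ((x + ∑ j ∈ M \ C, y j) ^ (((M \ C).card : ℤ) - 1)
        * (x + ∑ j ∈ M, y j) ^ (1 - (M.card : ℤ))))
      (∑ C ∈ M.powerset, K C *
        ((((M \ C).card : ℝ) - 1) * (x + ∑ j ∈ M \ C, y j) ^ (((M \ C).card : ℤ) - 2)
            * (x + ∑ j ∈ M, y j) ^ (1 - (M.card : ℤ))
          + (x + ∑ j ∈ M \ C, y j) ^ (((M \ C).card : ℤ) - 1)
            * ((1 - (M.card : ℝ)) * (x + ∑ j ∈ M, y j) ^ (-(M.card : ℤ))))) x := by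
    intro x hx
    refine HasDerivAt.fun_sum fun C _ ↦ HasDerivAt.const_mul _ ?_
    have h1 := (hasDerivAt_zpow (((M \ C).card : ℤ) - 1) _
      (Or.inl (hpos x hx (M \ C) Finset.sdiff_subset).ne')).comp_add_const x (∑ j ∈ M \ C, y j)
    have h2 := (hasDerivAt_zpow (1 - (M.card : ℤ)) _
      (Or.inl (hpos x hx M subset_rfl).ne')).comp_add_const x (∑ j ∈ M, y j)
    convert h1.fun_mul h2 using 1
    push_cast
    rw [show ((M \ C).card : ℤ) - 1 - 1 = (M \ C).card - 2 by ring,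
      show 1 - (M.card : ℤ) - 1 = -M.card by ring]
  refine antitoneOn_of_deriv_nonpos (convex_Ioi 0)
    (fun x hx ↦ (hder x hx).continuousAt.continuousWithinAt) ?_ ?_ <;> rw [interior_Ioi]
  · exact fun x hx ↦ (hder x hx).differentiableAt.differentiableWithinAt
  intro x hx
  rw [(hder x hx).deriv]
  have hs := hpos x hx M subset_rfl
  have hfactor : ∀ C ∈ M.powerset, K C *
        ((((M \ C).card : ℝ) - 1) * (x + ∑ j ∈ M \ C, y j) ^ (((M \ C).card : ℤ) - 2)
            * (x + ∑ j ∈ M, y j) ^ (1 - (M.card : ℤ))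
          + (x + ∑ j ∈ M \ C, y j) ^ (((M \ C).card : ℤ) - 1)
            * ((1 - (M.card : ℝ)) * (x + ∑ j ∈ M, y j) ^ (-(M.card : ℤ))))
      = (x + ∑ j ∈ M, y j) ^ (-(M.card : ℤ)) * ∑ D ∈ C.powerset, K (C \ D) *
        ((((M \ C).card : ℝ) - 1) * (x + ∑ j ∈ M \ C, y j) ^ (((M \ C).card : ℤ) - 2)
            * (∑ j ∈ D, y j) ^ ((D.card : ℤ) - 1)
          - D.card * (x + ∑ j ∈ M \ C, y j) ^ (((M \ C).card : ℤ) - 1)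
            * (∑ j ∈ D, y j) ^ ((D.card : ℤ) - 2)) := by
    intro C hC
    have hC' := Finset.mem_powerset.1 hC
    have hX := hpos x hx (M \ C) Finset.sdiff_subset
    have hsum : x + ∑ j ∈ M, y j = (x + ∑ j ∈ M \ C, y j) + ∑ j ∈ C, y j := by
      rw [← Finset.sum_sdiff hC']
      ring
    have hcard : (M.card : ℝ) = (M \ C).card + C.card := by
      rw [← Nat.cast_add, Finset.card_sdiff_add_card_eq_card hC']
    have e1 := sum_mul_of_recursion y K (hrec C hC') y
    have e2 := sum_mul_of_recursion y K (hrec C hC') fun _ ↦ 1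
    simp only [Finset.sum_const, nsmul_eq_mul, mul_one] at e2
    have hD : ∀ D ∈ C.powerset, K (C \ D) *
        ((((M \ C).card : ℝ) - 1) * (x + ∑ j ∈ M \ C, y j) ^ (((M \ C).card : ℤ) - 2)
            * (∑ j ∈ D, y j) ^ ((D.card : ℤ) - 1)
          - D.card * (x + ∑ j ∈ M \ C, y j) ^ (((M \ C).card : ℤ) - 1)
            * (∑ j ∈ D, y j) ^ ((D.card : ℤ) - 2))
        = (((M \ C).card : ℝ) - 1) * (x + ∑ j ∈ M \ C, y j) ^ (((M \ C).card : ℤ) - 2) *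
            ((∑ v ∈ D, y v) * ((∑ j ∈ D, y j) ^ ((D.card : ℤ) - 2) * K (C \ D)))
          - (x + ∑ j ∈ M \ C, y j) ^ (((M \ C).card : ℤ) - 1) *
            (D.card * ((∑ j ∈ D, y j) ^ ((D.card : ℤ) - 2) * K (C \ D))) := by
      intro D hD
      have hpow : (∑ j ∈ D, y j) ^ ((D.card : ℤ) - 1)
          = (∑ j ∈ D, y j) * (∑ j ∈ D, y j) ^ ((D.card : ℤ) - 2) := by
        rcases D.eq_empty_or_nonempty with rfl | hne
        · simp
        · have hD0 : 0 < ∑ j ∈ D, y j := Finset.sum_pos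
            (fun j hj ↦ hy j (hC' (Finset.mem_powerset.1 hD hj))) hne
          rw [show (D.card : ℤ) - 1 = 1 + (D.card - 2) by ring, zpow_one_add₀ hD0.ne']
      rw [hpow]
      ring
    rw [Finset.sum_congr rfl hD, Finset.sum_sub_distrib, ← Finset.mul_sum, ← Finset.mul_sum,
      ← e1, ← e2, sub_eq_add_neg (1 : ℤ), zpow_one_add₀ hs.ne',
      show ((M \ C).card : ℤ) - 1 = 1 + ((M \ C).card - 2) by ring, zpow_one_add₀ hX.ne', hcard]
    generalize (x + ∑ j ∈ M, y j) ^ (-(M.card : ℤ)) = S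
    rw [hsum]
    ring
  rw [Finset.sum_congr rfl hfactor, ← Finset.mul_sum, sum_powerset_powerset]
  refine mul_nonpos_of_nonneg_of_nonpos (by positivity) (Finset.sum_nonpos fun E hE ↦ ?_)
  have hmain := two_tree_inequality y (M \ E) (fun j hj ↦ hy j (Finset.sdiff_subset hj)) hx
  have hterm : ∀ D ∈ (M \ E).powerset, K ((E ∪ D) \ D) *
        ((((M \ (E ∪ D)).card : ℝ) - 1)
            * (x + ∑ j ∈ M \ (E ∪ D), y j) ^ (((M \ (E ∪ D)).card : ℤ) - 2)
            * (∑ j ∈ D, y j) ^ ((D.card : ℤ) - 1)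
          - D.card * (x + ∑ j ∈ M \ (E ∪ D), y j) ^ (((M \ (E ∪ D)).card : ℤ) - 1)
            * (∑ j ∈ D, y j) ^ ((D.card : ℤ) - 2))
      = K E * ((((M \ E) \ D).card - 1 : ℝ)
            * (x + ∑ j ∈ (M \ E) \ D, y j) ^ ((((M \ E) \ D).card : ℤ) - 2)
            * (∑ j ∈ D, y j) ^ ((D.card : ℤ) - 1)
          - D.card * (x + ∑ j ∈ (M \ E) \ D, y j) ^ ((((M \ E) \ D).card : ℤ) - 1)
            * (∑ j ∈ D, y j) ^ ((D.card : ℤ) - 2)) := by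
    intro D hD
    have hdisj := (Finset.subset_sdiff.1 (Finset.mem_powerset.1 hD)).2
    rw [Finset.union_sdiff_cancel_right hdisj.symm, sdiff_sdiff_left, Finset.sup_eq_union]
  rw [Finset.sum_congr rfl hterm, ← Finset.mul_sum, Finset.sum_sub_distrib]
  exact mul_nonpos_of_nonneg_of_nonpos (hK E) (sub_nonpos.2 hmain)

end SubsetSums

section Graphs

open SimpleGraph

variable {t : ℕ}

/-- The mass of a graph with respect to real weights. -/
noncomputable def realMass (w : Fin t → ℝ) (G : SimpleGraph (Fin t)) : ℝ :=
  ∏ i, w i ^ deg G i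

/-- All edges of `G` lie inside `A`. -/
def EdgesIn (A : Finset (Fin t)) (G : SimpleGraph (Fin t)) : Prop :=
  ∀ ⦃u v⦄, G.Adj u v → u ∈ A

/-- The graph consisting of the edges of `G` inside `A`. -/
def edgesWithin (A : Finset (Fin t)) (G : SimpleGraph (Fin t)) : SimpleGraph (Fin t) where
  Adj u v := G.Adj u v ∧ u ∈ A ∧ v ∈ A
  symm := ⟨fun _ _ h ↦ ⟨h.1.symm, h.2.2, h.2.1⟩⟩
  loopless := ⟨fun _ h ↦ h.1.ne rfl⟩

open Classical in
/-- The forests with vertex set `A`. -/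
noncomputable def forestsOn (A : Finset (Fin t)) : Finset (SimpleGraph (Fin t)) :=
  Finset.univ.filter fun G ↦ EdgesIn A G ∧ G.IsAcyclic

open Classical in
/-- The trees with vertex set `A`. -/
noncomputable def treesOn (A : Finset (Fin t)) : Finset (SimpleGraph (Fin t)) :=
  Finset.univ.filter fun G ↦
    EdgesIn A G ∧ G.IsAcyclic ∧ ∀ u ∈ A, ∀ v ∈ A, G.Reachable u v

/-- The total mass of the forests with vertex set `A`. -/
noncomputable def forestMass (w : Fin t → ℝ) (A : Finset (Fin t)) : ℝ :=
  ∑ G ∈ forestsOn A, realMass w G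

/-- The total mass of the trees with vertex set `A`. -/
noncomputable def treeMass (w : Fin t → ℝ) (A : Finset (Fin t)) : ℝ :=
  ∑ G ∈ treesOn A, realMass w G

lemma mem_forestsOn {A : Finset (Fin t)} {G : SimpleGraph (Fin t)} :
    G ∈ forestsOn A ↔ EdgesIn A G ∧ G.IsAcyclic := by
  simp [forestsOn]

lemma mem_treesOn {A : Finset (Fin t)} {G : SimpleGraph (Fin t)} :
    G ∈ treesOn A ↔ EdgesIn A G ∧ G.IsAcyclic ∧ ∀ u ∈ A, ∀ v ∈ A, G.Reachable u v := by
  simp [treesOn]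

lemma edgesWithin_le (A : Finset (Fin t)) (G : SimpleGraph (Fin t)) : edgesWithin A G ≤ G :=
  fun _ _ h ↦ h.1

lemma edgesIn_edgesWithin (A : Finset (Fin t)) (G : SimpleGraph (Fin t)) :
    EdgesIn A (edgesWithin A G) := fun _ _ h ↦ h.2.1

lemma EdgesIn.right {A : Finset (Fin t)} {G : SimpleGraph (Fin t)} (h : EdgesIn A G)
    {u v : Fin t} (huv : G.Adj u v) : v ∈ A := h huv.symm

/-- Walks from a vertex stay inside a set which is closed under adjacency. -/
lemma reachable_of_closed {G H : SimpleGraph (Fin t)} {P : Fin t → Prop} {u v : Fin t}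
    (hu : P u) (hstep : ∀ a b, P a → G.Adj a b → P b ∧ H.Adj a b) (h : G.Reachable u v) :
    P v ∧ H.Reachable u v := by
  rw [reachable_iff_reflTransGen] at h
  induction h with
  | refl => exact ⟨hu, .refl _⟩
  | tail _ hab ih =>
    obtain ⟨hPb, hHb⟩ := hstep _ _ ih.1 hab
    exact ⟨hPb, ih.2.trans hHb.reachable⟩

lemma realMass_sup {w : Fin t → ℝ} {G H : SimpleGraph (Fin t)} (h : Disjoint G H) :
    realMass w (G ⊔ H) = realMass w G * realMass w H := by
  rw [realMass, realMass, realMass, ← Finset.prod_mul_distrib]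
  refine Finset.prod_congr rfl fun i _ ↦ ?_
  rw [← pow_add]
  congr 1
  rw [deg, deg, deg, ← Set.ncard_union_eq]
  · congr 1
  · rw [Set.disjoint_left]
    intro v hG hH
    exact (disjoint_iff.1 h ▸ (show (G ⊓ H).Adj i v from ⟨hG, hH⟩) : (⊥ : SimpleGraph _).Adj i v)

lemma realMass_bot (w : Fin t → ℝ) : realMass w ⊥ = 1 := by
  simp [realMass, deg]

lemma realMass_edge (w : Fin t → ℝ) {p b : Fin t} (h : p ≠ b) :
    realMass w (edge p b) = w p * w b := by
  have hdeg : ∀ i, deg (edge p b) i = if i = p ∨ i = b then 1 else 0 := by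
    intro i
    split_ifs with hi
    · rw [deg, Set.ncard_eq_one]
      rcases hi with rfl | rfl
      · exact ⟨b, by ext v; simp [edge_adj]; grind⟩
      · exact ⟨p, by ext v; simp [edge_adj]; grind⟩
    · rw [deg, Set.ncard_eq_zero]
      ext v
      simp [edge_adj]
      grind
  simp only [realMass, hdeg]
  rw [← Finset.prod_subset (Finset.subset_univ {p, b})]
  · simp [Finset.prod_pair h]
  · intro i _ hi
    simp only [Finset.mem_insert, Finset.mem_singleton] at hi
    simp [hi]

lemma EdgesIn.disjoint {A C : Finset (Fin t)} {G H : SimpleGraph (Fin t)} (hG : EdgesIn A G)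
    (hH : EdgesIn C H) (hAC : Disjoint A C) : Disjoint G H := by
  rw [disjoint_iff]
  ext u v
  simp only [inf_adj, bot_adj, iff_false, not_and]
  exact fun h h' ↦ Finset.disjoint_left.1 hAC (hG h) (hH h')

lemma reachable_of_reachable_sup {A C : Finset (Fin t)} {G H : SimpleGraph (Fin t)}
    (hG : EdgesIn A G) (hH : EdgesIn C H) (hAC : Disjoint A C) {u v : Fin t} (hu : u ∈ A)
    (h : (G ⊔ H).Reachable u v) : v ∈ A ∧ G.Reachable u v := by
  refine reachable_of_closed hu (fun a b ha hab ↦ ?_) h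
  rcases hab with hab | hab
  · exact ⟨hG.right hab, hab⟩
  · exact absurd (hH hab) (Finset.disjoint_left.1 hAC ha)

lemma isBridge_sup_left {A C : Finset (Fin t)} {G H : SimpleGraph (Fin t)}
    (hG : EdgesIn A G) (hH : EdgesIn C H) (hAC : Disjoint A C) (hGa : G.IsAcyclic)
    {u v : Fin t} (huv : G.Adj u v) : (G ⊔ H).IsBridge s(u, v) := by
  have hb := isAcyclic_iff_forall_adj_isBridge.1 hGa huv
  rw [isBridge_iff] at hb ⊢
  refine fun h ↦ hb (reachable_of_closed (P := (· ∈ A)) (hG huv) (fun a b ha hab ↦ ?_) h).2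
  rw [deleteEdges_adj] at hab ⊢
  rcases hab.1 with hab' | hab'
  · exact ⟨hG.right hab', hab', hab.2⟩
  · exact absurd (hH hab') (Finset.disjoint_left.1 hAC ha)

lemma isAcyclic_sup {A C : Finset (Fin t)} {G H : SimpleGraph (Fin t)}
    (hG : EdgesIn A G) (hH : EdgesIn C H) (hAC : Disjoint A C) (hGa : G.IsAcyclic)
    (hHa : H.IsAcyclic) : (G ⊔ H).IsAcyclic := by
  rw [isAcyclic_iff_forall_adj_isBridge]
  rintro u v (huv | huv)
  · exact isBridge_sup_left hG hH hAC hGa huv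
  · rw [sup_comm]
    exact isBridge_sup_left hH hG hAC.symm hHa huv

lemma edgesWithin_sup {A C : Finset (Fin t)} {G H : SimpleGraph (Fin t)}
    (hG : EdgesIn A G) (hH : EdgesIn C H) (hAC : Disjoint A C) :
    edgesWithin A (G ⊔ H) = G := by
  ext u v
  constructor
  · rintro ⟨h | h, hu, -⟩
    · exact h
    · exact absurd (hH h) (Finset.disjoint_left.1 hAC hu)
  · exact fun h ↦ ⟨Or.inl h, hG h, hG.right h⟩

open Classical in
/-- The vertex set of the component of `v` in `G`. -/
noncomputable def componentOf (G : SimpleGraph (Fin t)) (v : Fin t) : Finset (Fin t) :=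
  Finset.univ.filter fun u ↦ G.Reachable v u

lemma mem_componentOf {G : SimpleGraph (Fin t)} {v u : Fin t} :
    u ∈ componentOf G v ↔ G.Reachable v u := by
  simp [componentOf]

/-- Decomposition of a forest into the component of `v` and the rest. -/
lemma forestMass_eq_sum (w : Fin t → ℝ) {S : Finset (Fin t)} {v : Fin t} (hv : v ∈ S) :
    forestMass w S = ∑ A ∈ S.powerset with v ∈ A, treeMass w A * forestMass w (S \ A) := by
  have hmaps : ∀ G ∈ forestsOn S, componentOf G v ∈ S.powerset.filter (v ∈ ·) := by
    intro G hG
    simp only [Finset.mem_filter, Finset.mem_powerset, mem_componentOf]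
    refine ⟨fun u hu ↦ ?_, .refl _⟩
    exact (reachable_of_closed (P := (· ∈ S)) (H := G) hv
      (fun a b _ hab ↦ ⟨(mem_forestsOn.1 hG).1.right hab, hab⟩) (mem_componentOf.1 hu)).1
  rw [forestMass, ← Finset.sum_fiberwise_of_maps_to hmaps]
  refine Finset.sum_congr rfl fun A hA ↦ ?_
  rw [Finset.mem_filter, Finset.mem_powerset] at hA
  rw [treeMass, forestMass, Finset.sum_mul_sum, ← Finset.sum_product']
  symm
  have hdisj : Disjoint A (S \ A) := Finset.disjoint_sdiff
  refine Finset.sum_nbij' (fun p ↦ p.1 ⊔ p.2)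
    (fun G ↦ (edgesWithin A G, edgesWithin (S \ A) G)) ?_ ?_ ?_ ?_ ?_
  · rintro ⟨G, H⟩ h
    obtain ⟨hG, hH⟩ := Finset.mem_product.1 h
    rw [mem_treesOn] at hG
    rw [mem_forestsOn] at hH
    rw [Finset.mem_filter, mem_forestsOn]
    refine ⟨⟨?_, isAcyclic_sup hG.1 hH.1 hdisj hG.2.1 hH.2⟩, ?_⟩
    · rintro a b (hab | hab)
      · exact hA.1 (hG.1 hab)
      · exact Finset.sdiff_subset (hH.1 hab)
    · ext u
      rw [mem_componentOf]
      exact ⟨fun hu ↦ (reachable_of_reachable_sup hG.1 hH.1 hdisj hA.2 hu).1,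
        fun hu ↦ (hG.2.2 v hA.2 u hu).mono le_sup_left⟩
  · intro G hG
    rw [Finset.mem_filter, mem_forestsOn] at hG
    obtain ⟨⟨hGS, hGa⟩, rfl⟩ := hG
    rw [Finset.mem_product, mem_treesOn, mem_forestsOn]
    refine ⟨⟨edgesIn_edgesWithin _ _, hGa.anti (edgesWithin_le _ _), ?_⟩,
      edgesIn_edgesWithin _ _, hGa.anti (edgesWithin_le _ _)⟩
    have key : ∀ u ∈ componentOf G v, (edgesWithin (componentOf G v) G).Reachable v u := by
      intro u hu
      refine (reachable_of_closed (P := (· ∈ componentOf G v)) hA.2 (fun a b ha hab ↦ ?_)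
        (mem_componentOf.1 hu)).2
      have hb : b ∈ componentOf G v :=
        mem_componentOf.2 ((mem_componentOf.1 ha).trans hab.reachable)
      exact ⟨hb, hab, ha, hb⟩
    exact fun a ha b hb ↦ (key a ha).symm.trans (key b hb)
  · rintro ⟨G, H⟩ h
    obtain ⟨hG, hH⟩ := Finset.mem_product.1 h
    rw [mem_treesOn] at hG
    rw [mem_forestsOn] at hH
    simp only [Prod.mk.injEq]
    refine ⟨edgesWithin_sup hG.1 hH.1 hdisj, ?_⟩
    rw [sup_comm]
    exact edgesWithin_sup hH.1 hG.1 hdisj.symm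
  · intro G hG
    rw [Finset.mem_filter, mem_forestsOn] at hG
    obtain ⟨⟨hGS, hGa⟩, rfl⟩ := hG
    ext a b
    refine ⟨fun h ↦ h.elim (·.1) (·.1), fun h ↦ ?_⟩
    by_cases ha : a ∈ componentOf G v
    · exact Or.inl ⟨h, ha, mem_componentOf.2 ((mem_componentOf.1 ha).trans h.reachable)⟩
    · refine Or.inr ⟨h, Finset.mem_sdiff.2 ⟨hGS h, ha⟩, Finset.mem_sdiff.2 ⟨hGS.right h, ?_⟩⟩
      exact fun hb ↦ ha (mem_componentOf.2 ((mem_componentOf.1 hb).trans h.symm.reachable))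
  · rintro ⟨G, H⟩ h
    obtain ⟨hG, hH⟩ := Finset.mem_product.1 h
    exact (realMass_sup
      ((mem_treesOn.1 hG).1.disjoint (mem_forestsOn.1 hH).1 hdisj)).symm

/-- Decomposition of a tree at the edge through which `p` is joined to the branch of `q`. -/
lemma treeMass_eq_sum (w : Fin t → ℝ) {S : Finset (Fin t)} {p q : Fin t} (hp : p ∈ S)
    (hq : q ∈ S) (hpq : p ≠ q) :
    treeMass w S = ∑ B ∈ (S.erase p).powerset with q ∈ B,
      treeMass w B * treeMass w (S \ B) * ∑ b ∈ B, w p * w b := by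
  set U : Finset (Fin t) := Finset.univ.erase p with hU
  have hmemU : ∀ {a}, a ∈ U ↔ a ≠ p := by simp [hU]
  have hmaps : ∀ K ∈ treesOn S,
      componentOf (edgesWithin U K) q ∈ (S.erase p).powerset.filter (q ∈ ·) := by
    intro K hK
    simp only [Finset.mem_filter, Finset.mem_powerset, mem_componentOf]
    refine ⟨fun u hu ↦ ?_, .refl _⟩
    refine (reachable_of_closed (P := (· ∈ S.erase p)) (H := K)
      (Finset.mem_erase.2 ⟨hpq.symm, hq⟩) (fun a b _ hab ↦ ?_) (mem_componentOf.1 hu)).1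
    exact ⟨Finset.mem_erase.2 ⟨hmemU.1 hab.2.2, (mem_treesOn.1 hK).1.right hab.1⟩, hab.1⟩
  rw [treeMass, ← Finset.sum_fiberwise_of_maps_to hmaps]
  refine Finset.sum_congr rfl fun B hB ↦ ?_
  rw [Finset.mem_filter, Finset.mem_powerset, Finset.subset_erase] at hB
  obtain ⟨⟨hBS, hpB⟩, hqB⟩ := hB
  have hdisj : Disjoint B (S \ B) := Finset.disjoint_sdiff
  have hpB' : p ∈ S \ B := Finset.mem_sdiff.2 ⟨hp, hpB⟩
  rw [treeMass, treeMass, Finset.sum_mul_sum, ← Finset.sum_product', Finset.sum_mul_sum,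
    ← Finset.sum_product']
  symm
  refine Finset.sum_nbij (fun x ↦ x.1.1 ⊔ x.1.2 ⊔ edge p x.2) ?_ ?_ ?_ ?_
  · rintro ⟨⟨G, H⟩, b⟩ h
    simp only [Finset.mem_product, mem_treesOn] at h
    obtain ⟨⟨⟨hGB, hGa, hGc⟩, hHB, hHa, hHc⟩, hb⟩ := h
    have hpb : p ≠ b := fun h ↦ hpB (h ▸ hb)
    have hadj : (G ⊔ H ⊔ edge p b).Adj p b := Or.inr (by simp [edge_adj, hpb])
    rw [Finset.mem_filter, mem_treesOn]
    refine ⟨⟨?_, ?_, ?_⟩, ?_⟩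
    · rintro u v ((huv | huv) | huv)
      · exact hBS (hGB huv)
      · exact Finset.sdiff_subset (hHB huv)
      · rw [edge_adj] at huv
        rcases huv.1 with ⟨rfl, -⟩ | ⟨rfl, -⟩
        · exact hp
        · exact hBS hb
    · refine (isAcyclic_sup hGB hHB hdisj hGa hHa).sup_edge_of_not_reachable fun h ↦ hpB ?_
      exact (reachable_of_reachable_sup hGB hHB hdisj hb h.symm).1
    · have key : ∀ u ∈ S, (G ⊔ H ⊔ edge p b).Reachable p u := by
        intro u hu
        by_cases huB : u ∈ B
        · exact hadj.reachable.trans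
            ((hGc b hb u huB).mono (le_sup_left.trans le_sup_left))
        · exact (hHc p hpB' u (Finset.mem_sdiff.2 ⟨hu, huB⟩)).mono
            (le_sup_right.trans le_sup_left)
      exact fun u hu v hv ↦ (key u hu).symm.trans (key v hv)
    · ext u
      rw [mem_componentOf]
      constructor
      · intro hu
        refine (reachable_of_closed (P := (· ∈ B)) (H := ⊤) hqB (fun a c ha hac ↦ ?_) hu).1
        refine ⟨?_, hac.1.ne⟩
        rcases hac.1 with (h | h) | h
        · exact hGB.right h
        · exact absurd (hHB h) (Finset.disjoint_left.1 hdisj ha)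
        · rw [edge_adj] at h
          rcases h.1 with ⟨rfl, -⟩ | ⟨-, rfl⟩
          · exact absurd ha hpB
          · exact absurd rfl (hmemU.1 hac.2.2)
      · intro hu
        refine (hGc q hqB u hu).mono fun a c hac ↦ ⟨Or.inl (Or.inl hac), ?_, ?_⟩
        · exact hmemU.2 fun h ↦ hpB (h ▸ hGB hac)
        · exact hmemU.2 fun h ↦ hpB (h ▸ hGB.right hac)
  · have recover : ∀ {G H : SimpleGraph (Fin t)} {b : Fin t},
        EdgesIn B G → EdgesIn (S \ B) H → b ∈ B →
        edgesWithin B (G ⊔ H ⊔ edge p b) = G ∧ edgesWithin (S \ B) (G ⊔ H ⊔ edge p b) = H ∧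
          ∀ c, (G ⊔ H ⊔ edge p b).Adj p c ∧ c ∈ B ↔ c = b := by
      intro G H b hG hH hb
      have hpb : p ≠ b := fun h ↦ hpB (h ▸ hb)
      refine ⟨?_, ?_, fun c ↦ ⟨?_, ?_⟩⟩
      · ext u v
        refine ⟨?_, fun h ↦ ⟨Or.inl (Or.inl h), hG h, hG.right h⟩⟩
        rintro ⟨(h | h) | h, hu, hv⟩
        · exact h
        · exact absurd (hH h) (Finset.disjoint_left.1 hdisj hu)
        · rw [edge_adj] at h
          rcases h.1 with ⟨rfl, -⟩ | ⟨-, rfl⟩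
          · exact absurd hu hpB
          · exact absurd hv hpB
      · ext u v
        refine ⟨?_, fun h ↦ ⟨Or.inl (Or.inr h), hH h, hH.right h⟩⟩
        rintro ⟨(h | h) | h, hu, hv⟩
        · exact absurd hu (Finset.disjoint_left.1 hdisj (hG h))
        · exact h
        · rw [edge_adj] at h
          rcases h.1 with ⟨-, rfl⟩ | ⟨rfl, -⟩
          · exact absurd hv (Finset.disjoint_left.1 hdisj hb)
          · exact absurd hu (Finset.disjoint_left.1 hdisj hb)
      · rintro ⟨(h | h) | h, hc⟩
        · exact absurd (hG h) hpB
        · exact absurd (hH.right h) (Finset.disjoint_left.1 hdisj hc)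
        · rw [edge_adj] at h
          rcases h.1 with ⟨-, rfl⟩ | ⟨h', -⟩
          · rfl
          · exact absurd h' hpb
      · rintro rfl
        exact ⟨Or.inr (by simp [edge_adj, hpb]), hb⟩
    rintro ⟨⟨G, H⟩, b⟩ h ⟨⟨G', H'⟩, b'⟩ h' heq
    simp only [Finset.coe_product, Set.mem_prod, Finset.mem_coe, mem_treesOn] at h h'
    simp only at heq
    obtain ⟨h1, h2, h3⟩ := recover h.1.1.1 h.1.2.1 h.2
    obtain ⟨h1', h2', h3'⟩ := recover h'.1.1.1 h'.1.2.1 h'.2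
    rw [heq] at h1 h2 h3
    rw [h1.symm.trans h1', h2.symm.trans h2', (h3' b).1 ((h3 b).2 rfl)]
  · intro K hK
    rw [Finset.mem_coe, Finset.mem_filter, mem_treesOn] at hK
    obtain ⟨⟨hKS, hKa, hKc⟩, rfl⟩ := hK
    set B := componentOf (edgesWithin U K) q with hBdef
    have hclosed : ∀ {a c}, a ∈ B → K.Adj a c → c ≠ p → c ∈ B := by
      intro a c ha hac hc
      refine mem_componentOf.2 ((mem_componentOf.1 ha).trans (Adj.reachable ⟨hac, ?_, ?_⟩))
      · exact hmemU.2 fun h ↦ hpB (h ▸ ha)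
      · exact hmemU.2 hc
    obtain ⟨b, hb, hpb⟩ : ∃ b ∈ B, K.Adj p b := by
      by_contra! hcon
      refine hpB (reachable_of_closed (P := (· ∈ B)) (H := K) hqB (fun a c ha hac ↦ ?_)
        (hKc q hq p hp)).1
      refine ⟨hclosed ha hac fun h ↦ ?_, hac⟩
      subst h
      exact hcon a ha hac.symm
    have huniq : ∀ c ∈ B, K.Adj p c → c = b := by
      intro c hc hpc
      by_contra hne
      have hbr := isAcyclic_iff_forall_adj_isBridge.1 hKa hpb
      rw [isBridge_iff] at hbr
      refine hbr (Reachable.trans (v := c) (Adj.reachable ?_) ?_)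
      · rw [deleteEdges_adj]
        refine ⟨hpc, ?_⟩
        simp only [Set.mem_singleton_iff, Sym2.eq_iff]
        rintro (⟨-, h⟩ | ⟨h, -⟩)
        · exact hne h
        · exact hpb.ne h
      · refine ((mem_componentOf.1 hc).symm.trans (mem_componentOf.1 hb)).mono fun a d had ↦ ?_
        rw [deleteEdges_adj]
        refine ⟨had.1, ?_⟩
        simp only [Set.mem_singleton_iff, Sym2.eq_iff]
        rintro (⟨h, -⟩ | ⟨-, h⟩)
        · exact hmemU.1 had.2.1 h
        · exact hmemU.1 had.2.2 h
    refine ⟨((edgesWithin B K, edgesWithin (S \ B) K), b), ?_, ?_⟩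
    · simp only [Finset.coe_product, Set.mem_prod, Finset.mem_coe, mem_treesOn]
      refine ⟨⟨⟨edgesIn_edgesWithin _ _, hKa.anti (edgesWithin_le _ _), ?_⟩,
        edgesIn_edgesWithin _ _, hKa.anti (edgesWithin_le _ _), ?_⟩, hb⟩
      · have key : ∀ u ∈ B, (edgesWithin B K).Reachable q u := by
          intro u hu
          refine (reachable_of_closed (P := (· ∈ B)) hqB (fun a c ha hac ↦ ?_)
            (mem_componentOf.1 hu)).2
          have hc := hclosed ha hac.1 (hmemU.1 hac.2.2)
          exact ⟨hc, hac.1, ha, hc⟩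
        exact fun u hu v hv ↦ (key u hu).symm.trans (key v hv)
      · have key : ∀ u, K.Reachable u p → u ∈ S \ B → (edgesWithin (S \ B) K).Reachable u p := by
          intro u hu
          rw [reachable_iff_reflTransGen] at hu
          induction hu using Relation.ReflTransGen.head_induction_on with
          | refl => exact fun _ ↦ .refl _
          | @head a c hac _ ih =>
            intro ha
            by_cases hap : a = p
            · rw [hap]
            have hc : c ∈ S \ B := Finset.mem_sdiff.2 ⟨hKS.right hac, fun hc ↦
              (Finset.mem_sdiff.1 ha).2 (hclosed hc hac.symm hap)⟩
            exact (Adj.reachable (G := edgesWithin (S \ B) K) ⟨hac, ha, hc⟩).trans (ih hc)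
        have key' : ∀ u ∈ S \ B, (edgesWithin (S \ B) K).Reachable u p := fun u hu ↦
          key u (hKc u (Finset.sdiff_subset hu) p hp) hu
        exact fun u hu v hv ↦ (key' u hu).trans (key' v hv).symm
    · ext u v
      constructor
      · rintro ((h | h) | h)
        · exact h.1
        · exact h.1
        · rw [edge_adj] at h
          rcases h.1 with ⟨rfl, rfl⟩ | ⟨rfl, rfl⟩
          · exact hpb
          · exact hpb.symm
      · intro h
        by_cases hu : u ∈ B <;> by_cases hv : v ∈ B
        · exact Or.inl (Or.inl ⟨h, hu, hv⟩)
        · have hvp : v = p := by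
            by_contra hne
            exact hv (hclosed hu h hne)
          subst hvp
          have := huniq u hu h.symm
          subst this
          exact Or.inr (by simp [edge_adj, h.ne])
        · have hup : u = p := by
            by_contra hne
            exact hu (hclosed hv h.symm hne)
          subst hup
          have := huniq v hv h
          subst this
          exact Or.inr (by simp [edge_adj, h.ne])
        · exact Or.inl (Or.inr ⟨h, Finset.mem_sdiff.2 ⟨hKS h, hu⟩,
            Finset.mem_sdiff.2 ⟨hKS.right h, hv⟩⟩)
  · rintro ⟨⟨G, H⟩, b⟩ h
    simp only [Finset.mem_product, mem_treesOn] at h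
    obtain ⟨⟨⟨hGB, -, -⟩, hHB, -, -⟩, hb⟩ := h
    have hpb : p ≠ b := fun h ↦ hpB (h ▸ hb)
    rw [realMass_sup, realMass_sup (hGB.disjoint hHB hdisj), realMass_edge w hpb]
    rw [disjoint_iff]
    ext u v
    simp only [inf_adj, sup_adj, edge_adj, bot_adj, iff_false]
    rintro ⟨h | h, ⟨rfl, rfl⟩ | ⟨rfl, rfl⟩, -⟩
    · exact hpB (hGB h)
    · exact hpB (hGB.right h)
    · exact Finset.disjoint_left.1 hdisj hb (hHB.right h)
    · exact Finset.disjoint_left.1 hdisj hb (hHB h)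

lemma treeMass_singleton (w : Fin t → ℝ) (p : Fin t) : treeMass w {p} = 1 := by
  have : treesOn {p} = {(⊥ : SimpleGraph (Fin t))} := by
    ext G
    rw [mem_treesOn, Finset.mem_singleton]
    constructor
    · rintro ⟨h, -⟩
      ext u v
      simp only [bot_adj, iff_false]
      intro huv
      exact huv.ne ((Finset.mem_singleton.1 (h huv)).trans
        (Finset.mem_singleton.1 (h.right huv)).symm)
    · rintro rfl
      refine ⟨fun _ _ h ↦ h.elim, isAcyclic_bot, fun u hu v hv ↦ ?_⟩
      rw [Finset.mem_singleton.1 hu, Finset.mem_singleton.1 hv]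
  rw [treeMass, this, Finset.sum_singleton, realMass_bot]

/-- The weighted Cayley formula. -/
lemma treeMass_eq (w : Fin t → ℝ) (hw : ∀ i, 0 < w i) (A : Finset (Fin t)) (hA : A.Nonempty) :
    treeMass w A = (∏ i ∈ A, w i) * (∑ i ∈ A, w i) ^ ((A.card : ℤ) - 2) := by
  induction A using Finset.strongInduction with
  | H S ih =>
  obtain ⟨p, hp⟩ := hA
  by_cases hS : ∃ q ∈ S, p ≠ q
  swap
  · have hSp : S = {p} := by
      refine Finset.eq_singleton_iff_unique_mem.2 ⟨hp, fun q hq ↦ ?_⟩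
      by_contra hne
      exact hS ⟨q, hq, fun h ↦ hne h.symm⟩
    subst hSp
    rw [treeMass_singleton, Finset.prod_singleton, Finset.sum_singleton, Finset.card_singleton]
    have := (hw p).ne'
    norm_num
    field_simp
  obtain ⟨q, hq, hpq⟩ := hS
  have hqS : q ∈ S.erase p := Finset.mem_erase.2 ⟨hpq.symm, hq⟩
  rw [treeMass_eq_sum w hp hq hpq, sum_powerset_filter_mem hqS]
  set M := (S.erase p).erase q with hM
  have hcard : S.card = M.card + 2 := by
    rw [hM, Finset.card_erase_of_mem hqS, Finset.card_erase_of_mem hp]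
    have : 0 < (S.erase p).card := Finset.card_pos.2 ⟨q, hqS⟩
    rw [Finset.card_erase_of_mem hp] at this
    omega
  have hsum : ∑ i ∈ S, w i = w p + w q + ∑ i ∈ M, w i := by
    rw [add_assoc, hM, Finset.add_sum_erase _ _ hqS, Finset.add_sum_erase _ _ hp]
  have hterm : ∀ D ∈ M.powerset,
      treeMass w (insert q D) * treeMass w (S \ insert q D) * ∑ b ∈ insert q D, w p * w b
        = (∏ i ∈ S, w i) * (w p * (w p + ∑ j ∈ M \ D, w j) ^ (((M \ D).card : ℤ) - 1)
          * (w q + ∑ j ∈ D, w j) ^ D.card) := by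
    intro D hD
    have hDM := Finset.mem_powerset.1 hD
    have hqD : q ∉ D := fun h ↦ by simpa [hM] using hDM h
    have hpD : p ∉ D := fun h ↦ by simpa [hM] using hDM h
    have hpqD : p ∉ insert q D := by simp [hpq, hpD]
    have hDS : insert q D ⊆ S := Finset.insert_subset hq
      (hDM.trans ((Finset.erase_subset _ _).trans (Finset.erase_subset _ _)))
    have hrest : S \ insert q D = insert p (M \ D) := by
      ext a
      simp only [hM, Finset.mem_sdiff, Finset.mem_insert, Finset.mem_erase]
      grind
    have hpM : p ∉ M \ D := by simp [hM]
    have hB0 : 0 < w q + ∑ j ∈ D, w j :=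
      add_pos_of_pos_of_nonneg (hw q) (Finset.sum_nonneg fun j _ ↦ (hw j).le)
    rw [ih (insert q D) (Finset.ssubset_iff_subset_ne.2 ⟨hDS, fun h ↦ hpqD (h ▸ hp)⟩)
        (Finset.insert_nonempty _ _),
      ih (S \ insert q D) (Finset.ssubset_iff_subset_ne.2 ⟨Finset.sdiff_subset, fun h ↦ by
        have : q ∈ S \ insert q D := h.symm.subset hq
        simp at this⟩) (hrest ▸ Finset.insert_nonempty _ _), ← Finset.prod_sdiff hDS, hrest,
      Finset.sum_insert hpM, Finset.card_insert_of_notMem hpM, Finset.card_insert_of_notMem hqD,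
      ← Finset.mul_sum, Finset.sum_insert hqD]
    push_cast
    rw [show ((M \ D).card : ℤ) + 1 - 2 = (M \ D).card - 1 by ring,
      show (D.card : ℤ) + 1 - 2 = D.card - 1 by ring, zpow_sub_one₀ hB0.ne', zpow_natCast]
    field_simp
  rw [Finset.sum_congr rfl hterm, ← Finset.mul_sum,
    hurwitz_sum w M (fun j _ ↦ hw j) (hw p), hsum, hcard]
  push_cast
  rw [add_sub_cancel_right, zpow_natCast]

lemma forestMass_nonneg {w : Fin t → ℝ} (hw : ∀ i, 0 < w i) (C : Finset (Fin t)) :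
    0 ≤ forestMass w C :=
  Finset.sum_nonneg fun _ _ ↦ Finset.prod_nonneg fun i _ ↦ pow_nonneg (hw i).le _

lemma forestMass_congr {w w' : Fin t → ℝ} {C : Finset (Fin t)} (h : ∀ i ∈ C, w i = w' i) :
    forestMass w C = forestMass w' C := by
  refine Finset.sum_congr rfl fun G hG ↦ Finset.prod_congr rfl fun i _ ↦ ?_
  by_cases hi : i ∈ C
  · rw [h i hi]
  · have : deg G i = 0 := by
      rw [deg, Set.ncard_eq_zero, Set.eq_empty_iff_forall_notMem]
      exact fun v hv ↦ hi ((mem_forestsOn.1 hG).1 hv)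
    rw [this, pow_zero, pow_zero]

lemma forestMass_div_prod_eq_sum {w : Fin t → ℝ} (hw : ∀ i, 0 < w i) {C : Finset (Fin t)}
    {v : Fin t} (hv : v ∈ C) :
    forestMass w C / ∏ j ∈ C, w j = ∑ D ∈ C.powerset with v ∈ D,
      (∑ j ∈ D, w j) ^ ((D.card : ℤ) - 2) * (forestMass w (C \ D) / ∏ j ∈ C \ D, w j) := by
  rw [forestMass_eq_sum w hv, Finset.sum_div]
  refine Finset.sum_congr rfl fun D hD ↦ ?_
  rw [Finset.mem_filter, Finset.mem_powerset] at hD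
  have h1 : (∏ j ∈ D, w j) ≠ 0 := (Finset.prod_pos fun j _ ↦ hw j).ne'
  have h2 : (∏ j ∈ C \ D, w j) ≠ 0 := (Finset.prod_pos fun j _ ↦ hw j).ne'
  rw [treeMass_eq w hw D ⟨v, hD.2⟩, ← Finset.prod_sdiff hD.1]
  field_simp

lemma forestMass_div_treeMass {w : Fin t → ℝ} (hw : ∀ i, 0 < w i) (i : Fin t) :
    forestMass w Finset.univ / treeMass w Finset.univ
      = ∑ C ∈ (Finset.univ.erase i).powerset, forestMass w C / (∏ j ∈ C, w j) *
        ((w i + ∑ j ∈ Finset.univ.erase i \ C, w j)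
            ^ (((Finset.univ.erase i \ C).card : ℤ) - 1)
          * (w i + ∑ j ∈ Finset.univ.erase i, w j)
            ^ (1 - ((Finset.univ.erase i).card : ℤ))) := by
  have hi : i ∈ (Finset.univ : Finset (Fin t)) := Finset.mem_univ i
  set M := (Finset.univ : Finset (Fin t)).erase i with hM
  have hs : 0 < w i + ∑ j ∈ M, w j :=
    add_pos_of_pos_of_nonneg (hw i) (Finset.sum_nonneg fun j _ ↦ (hw j).le)
  have hcard : (((Finset.univ : Finset (Fin t)).card : ℕ) : ℤ) = M.card + 1 := by
    rw [hM, ← Nat.cast_add_one, Finset.card_erase_add_one hi]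
  rw [treeMass_eq w hw _ ⟨i, hi⟩, ← div_div, forestMass_div_prod_eq_sum hw hi,
    sum_powerset_filter_mem hi, ← hM, ← Finset.add_sum_erase _ _ hi, ← hM, hcard,
    sum_powerset_compl, Finset.sum_div]
  refine Finset.sum_congr rfl fun C hC ↦ ?_
  have hC' := Finset.mem_powerset.1 hC
  have hiC : i ∉ M \ C := by simp [hM]
  have hrest : Finset.univ \ insert i (M \ C) = C := by
    rw [Finset.sdiff_insert, ← Finset.erase_sdiff_comm, ← hM, Finset.sdiff_sdiff_eq_self hC']
  rw [hrest, Finset.sum_insert hiC, Finset.card_insert_of_notMem hiC, div_eq_mul_inv _ (_ ^ _),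
    ← zpow_neg]
  push_cast
  rw [show ((M \ C).card : ℤ) + 1 - 2 = (M \ C).card - 1 by ring,
    show -((M.card : ℤ) + 1 - 2) = 1 - M.card by ring]
  ring

/-- Decreasing the weight of a single vertex increases the ratio of forest mass to tree mass. -/
lemma forestMass_div_treeMass_le_update {w : Fin t → ℝ} (hw : ∀ i, 0 < w i) (i : Fin t) {x : ℝ}
    (hx : 0 < x) (hxi : x ≤ w i) :
    forestMass w Finset.univ / treeMass w Finset.univ
      ≤ forestMass (Function.update w i x) Finset.univ
        / treeMass (Function.update w i x) Finset.univ := by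
  have hw' : ∀ j, 0 < Function.update w i x j := by
    intro j
    by_cases hj : j = i
    · subst hj
      simpa using hx
    · simpa [hj] using hw j
  set M := (Finset.univ : Finset (Fin t)).erase i with hM
  have hoff : ∀ j ∈ M, Function.update w i x j = w j := fun j hj ↦
    Function.update_of_ne (Finset.ne_of_mem_erase hj) _ _
  have hanti := antitoneOn_of_recursion w M (fun j _ ↦ hw j)
    (fun C ↦ forestMass w C / ∏ j ∈ C, w j)
    (fun C ↦ div_nonneg (forestMass_nonneg hw C) (Finset.prod_nonneg fun j _ ↦ (hw j).le))
    (fun C _ v hv ↦ forestMass_div_prod_eq_sum hw hv) hx (hw i) hxi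
  rw [forestMass_div_treeMass hw i, forestMass_div_treeMass hw' i]
  refine hanti.trans (Finset.sum_le_sum fun C hC ↦ ?_)
  have hC' := Finset.mem_powerset.1 hC
  rw [forestMass_congr fun j hj ↦ hoff j (hC' hj),
    Finset.prod_congr rfl fun j hj ↦ hoff j (hC' hj), Function.update_self,
    Finset.sum_congr rfl fun j hj ↦ hoff j (Finset.sdiff_subset hj),
    Finset.sum_congr rfl hoff]

lemma forestMass_div_treeMass_le_one {w : Fin t → ℝ} (hw : ∀ i, 1 ≤ w i) :
    forestMass w Finset.univ / treeMass w Finset.univ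
      ≤ forestMass (fun _ : Fin t ↦ 1) Finset.univ / treeMass (fun _ : Fin t ↦ 1) Finset.univ := by
  have key : ∀ J : Finset (Fin t), forestMass w Finset.univ / treeMass w Finset.univ
      ≤ forestMass (J.piecewise (fun _ ↦ 1) w) Finset.univ
        / treeMass (J.piecewise (fun _ ↦ 1) w) Finset.univ := by
    intro J
    induction J using Finset.induction_on with
    | empty => simp
    | insert i J hi ih =>
      have h1 : ∀ j, 1 ≤ J.piecewise (fun _ ↦ 1) w j :=
        Finset.le_piecewise_of_le_of_le J (f := fun _ ↦ 1) (fun _ ↦ le_rfl) hw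
      rw [Finset.piecewise_insert]
      exact ih.trans (forestMass_div_treeMass_le_update
        (fun j ↦ zero_lt_one.trans_le (h1 j)) i one_pos (h1 i))
  simpa using key Finset.univ

lemma coe_forestsOn_univ :
    (forestsOn (Finset.univ : Finset (Fin t)) : Set (SimpleGraph (Fin t)))
      = {F | F.IsAcyclic} := by
  ext G
  simp [mem_forestsOn, EdgesIn]

lemma coe_treesOn_univ [Nonempty (Fin t)] :
    (treesOn (Finset.univ : Finset (Fin t)) : Set (SimpleGraph (Fin t)))
      = {T | T.IsTree} := by
  ext G
  simp [mem_treesOn, EdgesIn, isTree_iff, connected_iff, Preconnected, and_comm]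
  exact fun _ _ ↦ inferInstance

lemma massSet_coe (w : Fin t → ℕ) (s : Finset (SimpleGraph (Fin t))) :
    massSet w s = ∑ G ∈ s, realMass (fun i ↦ (w i : ℝ)) G :=
  finsum_mem_coe_finset _ s

lemma sum_realMass_one (s : Finset (SimpleGraph (Fin t))) :
    ∑ G ∈ s, realMass (fun _ ↦ 1) G = s.card := by
  simp [realMass]

end Graphs

theorem mass_connected_prob_ge_uniform (t : ℕ) (ht : 2 ≤ t) (w : Fin t → ℕ)
    (hw : ∀ i, 0 < w i) :
    massSet w {T : SimpleGraph (Fin t) | T.IsTree}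
        * ({F : SimpleGraph (Fin t) | F.IsAcyclic}.ncard : ℝ)
      ≥ ({T : SimpleGraph (Fin t) | T.IsTree}.ncard : ℝ)
        * massSet w {F : SimpleGraph (Fin t) | F.IsAcyclic} := by
  have : Nonempty (Fin t) := ⟨⟨0, by omega⟩⟩
  rw [← coe_forestsOn_univ, ← coe_treesOn_univ, Set.ncard_coe_finset, Set.ncard_coe_finset,
    massSet_coe, massSet_coe, ← sum_realMass_one, ← sum_realMass_one]
  have h := forestMass_div_treeMass_le_one (w := fun i ↦ (w i : ℝ))
    fun i ↦ by exact_mod_cast hw i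
  have hpos : ∀ w : Fin t → ℝ, (∀ i, 0 < w i) → 0 < treeMass w Finset.univ := by
    intro w hw
    rw [treeMass_eq w hw _ Finset.univ_nonempty]
    exact mul_pos (Finset.prod_pos fun i _ ↦ hw i)
      (zpow_pos (Finset.sum_pos (fun i _ ↦ hw i) Finset.univ_nonempty) _)
  rw [div_le_div_iff₀ (hpos _ fun i ↦ by exact_mod_cast hw i) (hpos _ fun _ ↦ one_pos)] at h
  simp only [forestMass, treeMass] at h
  linarith
end

section
/- For integers n and j with 1 ≤ j < n/2, the number of forests on vertex set {1,…,n} whose fragment frag(F) equals j is exactly C(n,j) · |ℱ_j| · (n−j)^{n−j−2}, where C(n,j) is the binomial coefficient and ℱ_j is the set of forests on a j-element vertex set. -/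
/-- The number of forests on vertex set `{1,…,t}`. -/
noncomputable def forestCount (t : ℕ) : ℕ :=
  {F : SimpleGraph (Fin t) | F.IsAcyclic}.ncard

/-- The number of vertices in a largest connected component of `G`. -/
noncomputable def maxCompSize {n : ℕ} (G : SimpleGraph (Fin n)) : ℕ :=
  sSup {m : ℕ | ∃ c : G.ConnectedComponent, m = Nat.card c.supp}

/-- `frag G` is the number of vertices of `G` minus the number of vertices in a
largest connected component of `G`. -/
noncomputable def frag {n : ℕ} (G : SimpleGraph (Fin n)) : ℕ := n - maxCompSize G

open Function

/-- `RootOf f v r` says that following the parent map `f` from `v` ends at the root `r`. -/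
inductive RootOf {V : Type*} (f : V → Option V) : V → V → Prop
  | root {r : V} : f r = none → RootOf f r r
  | step {v w r : V} : f v = some w → RootOf f w r → RootOf f v r

namespace RootOf

variable {V : Type*} {f : V → Option V} {u v w x r s : V}

lemma eq_none (h : RootOf f v r) : f r = none := by
  induction h with
  | root h => exact h
  | step _ _ ih => exact ih

lemma eq_of_eq_none (h : RootOf f v r) (hv : f v = none) : v = r := by
  cases h with
  | root _ => rfl
  | step h _ => simp [hv] at h

lemma of_step (h : RootOf f v r) (hv : f v = some w) : RootOf f w r := by
  cases h with
  | root h => simp [hv] at h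
  | step h hr => rw [hv, Option.some_inj] at h; exact h ▸ hr

lemma unique (hr : RootOf f v r) (hs : RootOf f v s) : r = s := by
  induction hr with
  | root h => exact hs.eq_of_eq_none h
  | step h _ ih => exact ih (hs.of_step h)

variable [DecidableEq V]

lemma update_some (hx : RootOf f x r) (hv : f v = none) (hw : RootOf f w s) (hs : s ≠ v) :
    ∃ t, RootOf (update f v (some w)) x t := by
  have avoid : ∀ {y t}, RootOf f y t → t ≠ v → RootOf (update f v (some w)) y t := by
    intro y t hy ht
    induction hy with
    | root h => exact .root (by rwa [update_of_ne ht])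
    | @step a b c h _ ih =>
      refine .step (w := b) ?_ (ih ht)
      rwa [update_of_ne]
      rintro rfl
      simp [hv] at h
  induction hx with
  | @root r h =>
    by_cases hr : r = v
    · exact ⟨s, .step (w := w) (by simp [hr]) (avoid hw hs)⟩
    · exact ⟨r, avoid (.root h) hr⟩
  | @step a b c h _ ih =>
    obtain ⟨t, ht⟩ := ih
    refine ⟨t, .step (w := b) ?_ ht⟩
    rwa [update_of_ne]
    rintro rfl
    simp [hv] at h

lemma update_none (hx : RootOf f x r) (v : V) : ∃ t, RootOf (update f v none) x t := by
  induction hx with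
  | @root r h => exact ⟨r, .root (by simp [update_apply, h])⟩
  | @step a b c h _ ih =>
    obtain ⟨t, ht⟩ := ih
    by_cases ha : a = v
    · exact ⟨a, .root (by simp [ha])⟩
    · exact ⟨t, .step (w := b) (by rwa [update_of_ne ha]) ht⟩

/-- Cutting a rooted forest above `v` separates `v` from its parent. -/
lemma not_update_none (hx : RootOf f v r) (hv : f v = some w) :
    ¬ RootOf (update f v none) w v := by
  intro hwv
  have key : ∀ {x r}, RootOf f x r → ¬ RootOf (update f v none) x v := by
    intro x r hx
    induction hx with
    | @root r h =>
      intro hr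
      have := hr.eq_of_eq_none (by simp [update_apply, h])
      simp [← this, h] at hv
    | @step a b c h _ ih =>
      intro ha
      by_cases hav : a = v
      · subst hav
        rw [hv, Option.some_inj] at h
        exact ih (h ▸ hwv)
      · exact ih (ha.of_step (by rwa [update_of_ne hav]))
  exact key (hx.of_step hv) hwv

end RootOf

section Counting

open scoped Classical in
/-- Rooted forests on `V`, as parent maps, with exactly `k` roots. -/
noncomputable def rootedForests (V : Type*) [Fintype V] (k : ℕ) : Finset (V → Option V) :=
  {f | (∀ v, ∃ r, RootOf f v r) ∧ Fintype.card {v // f v = none} = k}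

variable {V : Type*} [Fintype V]

open scoped Classical in
lemma mem_rootedForests {k : ℕ} {f : V → Option V} :
    f ∈ rootedForests V k ↔
      (∀ v, ∃ r, RootOf f v r) ∧ (Finset.univ.filter fun v => f v = none).card = k := by
  simp [rootedForests, Fintype.card_subtype]

open scoped Classical in
lemma card_rootedForests_mul (k : ℕ) :
    (rootedForests V k).card * (Fintype.card V - k) =
      (rootedForests V (k + 1)).card * (Fintype.card V * k) := by
  have hL : ((rootedForests V k).sigma fun f => Finset.univ.filter fun v => f v ≠ none).card =
      (rootedForests V k).card * (Fintype.card V - k) := by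
    rw [Finset.card_sigma]
    refine Finset.sum_const_nat fun f hf => ?_
    have := Finset.card_filter_add_card_filter_not (s := Finset.univ) (fun v => f v = none)
    rw [(mem_rootedForests.1 hf).2, Finset.card_univ] at this
    simp only [ne_eq]
    omega
  have hR : ((rootedForests V (k + 1)).sigma fun f => Finset.univ.sigma fun w : V =>
      Finset.univ.filter fun v => f v = none ∧ ¬ RootOf f w v).card =
      (rootedForests V (k + 1)).card * (Fintype.card V * k) := by
    rw [Finset.card_sigma]
    refine Finset.sum_const_nat fun f hf => ?_
    obtain ⟨hf, hk⟩ := mem_rootedForests.1 hf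
    rw [Finset.card_sigma]
    refine Finset.sum_const_nat fun w _ => ?_
    obtain ⟨r, hr⟩ := hf w
    have : (Finset.univ.filter fun v => f v = none ∧ ¬ RootOf f w v) =
        (Finset.univ.filter fun v => f v = none).erase r := by
      ext v
      simp only [Finset.mem_filter, Finset.mem_univ, true_and, Finset.mem_erase]
      constructor
      · rintro ⟨h, h'⟩
        exact ⟨by rintro rfl; exact h' hr, h⟩
      · rintro ⟨h, h'⟩
        exact ⟨h', fun hv => h (hv.unique hr)⟩
    rw [this, Finset.card_erase_of_mem (by simp [hr.eq_none]), hk, Nat.add_sub_cancel]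
  rw [← hL, ← hR]
  symm
  refine Finset.card_bij (fun p _ => ⟨update p.1 p.2.2 (some p.2.1), p.2.2⟩) ?_ ?_ ?_
  · rintro ⟨f, w, v⟩ h
    simp only [Finset.mem_sigma, mem_rootedForests, Finset.mem_univ, Finset.mem_filter,
      true_and] at h ⊢
    obtain ⟨⟨hf, hk⟩, hv, hwv⟩ := h
    obtain ⟨s, hs⟩ := hf w
    refine ⟨⟨fun x => ?_, ?_⟩, by simp⟩
    · obtain ⟨r, hr⟩ := hf x
      exact hr.update_some hv hs (by rintro rfl; exact hwv hs)
    · have : (Finset.univ.filter fun x => update f v (some w) x = none) =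
          (Finset.univ.filter fun x => f x = none).erase v := by
        ext x
        by_cases hx : x = v <;> simp [hx, update_apply]
      rw [this, Finset.card_erase_of_mem (by simp [hv]), hk, Nat.add_sub_cancel]
  · rintro ⟨f, w, v⟩ h ⟨f', w', v'⟩ h' heq
    simp only [Finset.mem_sigma, Finset.mem_univ, Finset.mem_filter, true_and] at h h'
    simp only [Sigma.mk.injEq, heq_eq_eq] at heq
    obtain ⟨heq, rfl⟩ := heq
    have hw : w = w' := by simpa using congrFun heq v
    subst hw
    have hf : f = f' := by
      ext1 x
      by_cases hx : x = v
      · rw [hx, h.2.1, h'.2.1]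
      · simpa [hx] using congrFun heq x
    rw [hf]
  · rintro ⟨f, v⟩ h
    simp only [Finset.mem_sigma, mem_rootedForests, Finset.mem_univ, Finset.mem_filter,
      true_and] at h
    obtain ⟨⟨hf, hk⟩, hv⟩ := h
    obtain ⟨w, hw⟩ := Option.ne_none_iff_exists'.1 hv
    refine ⟨⟨update f v none, w, v⟩, ?_, ?_⟩
    · simp only [Finset.mem_sigma, mem_rootedForests, Finset.mem_univ, Finset.mem_filter,
        true_and]
      refine ⟨⟨fun x => (hf x).choose_spec.update_none v, ?_⟩, by simp,
        (hf v).choose_spec.not_update_none hw⟩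
      have : (Finset.univ.filter fun x => update f v none x = none) =
          insert v (Finset.univ.filter fun x => f x = none) := by
        ext x
        by_cases hx : x = v <;> simp [hx, update_apply]
      rw [this, Finset.card_insert_of_notMem (by simp [hv]), hk]
    · simp [← hw]

lemma card_rootedForests_card : (rootedForests V (Fintype.card V)).card = 1 := by
  classical
  rw [Finset.card_eq_one]
  refine ⟨fun _ => none, ?_⟩
  ext f
  rw [mem_rootedForests, Finset.mem_singleton]
  constructor
  · rintro ⟨-, h⟩
    ext1 v
    have := Finset.eq_univ_of_card _ h
    simpa using Finset.ext_iff.1 this v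
  · rintro rfl
    exact ⟨fun v => ⟨v, .root rfl⟩, by simp⟩

lemma card_rootedForests {N : ℕ} (hN : Fintype.card V = N + 1) {m : ℕ} (hm : m ≤ N) :
    (rootedForests V (N + 1 - m)).card = N.choose m * (N + 1) ^ m := by
  induction m with
  | zero => simpa [hN] using card_rootedForests_card (V := V)
  | succ m ih =>
    have h := card_rootedForests_mul (V := V) (N + 1 - (m + 1))
    rw [show N + 1 - (m + 1) + 1 = N + 1 - m by omega, ih (by omega), hN,
      show N + 1 - (N + 1 - (m + 1)) = m + 1 by omega] at h
    refine Nat.eq_of_mul_eq_mul_right (Nat.succ_pos m) (h.trans ?_)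
    rw [mul_right_comm _ _ (m + 1), Nat.choose_succ_right_eq,
      show N + 1 - (m + 1) = N - m by omega]
    ring

end Counting

section Graph

variable {V : Type*} {f g : V → Option V} {r : V}

/-- The graph joining every vertex to its parent. -/
def parentGraph (f : V → Option V) : SimpleGraph V := .fromRel fun u v => f u = some v

lemma not_parent_self {v t : V} (h : RootOf f v t) : f v ≠ some v := by
  intro hv
  induction h with
  | root h => simp [h] at hv
  | step h _ ih =>
    rw [h, Option.some_inj] at hv
    subst hv
    exact ih h

lemma parentGraph_adj_of_eq_some (hf : ∀ v, ∃ r, RootOf f v r) {v w : V} (h : f v = some w) :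
    (parentGraph f).Adj v w := by
  refine ⟨?_, .inl h⟩
  rintro rfl
  exact not_parent_self (hf v).choose_spec h

lemma parentGraph_connected (hf : ∀ v, RootOf f v r) : (parentGraph f).Connected := by
  have reach : ∀ {v t}, RootOf f v t → (parentGraph f).Reachable v t := by
    intro v t h
    induction h with
    | root _ => exact .rfl
    | step h _ ih => exact (parentGraph_adj_of_eq_some (fun v => ⟨r, hf v⟩) h).reachable.trans ih
  exact (SimpleGraph.connected_iff_exists_forall_reachable _).2 ⟨r, fun v => (reach (hf v)).symm⟩

lemma parentGraph_isTree [Finite V] (hf : ∀ v, RootOf f v r) : (parentGraph f).IsTree := by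
  have hconn := parentGraph_connected hf
  refine SimpleGraph.isTree_iff_connected_and_card.2
    ⟨hconn, le_antisymm ?_ hconn.card_vert_le_card_edgeSet_add_one⟩
  have hsub : (parentGraph f).edgeSet ⊆ (fun v => s(v, (f v).getD v)) '' {r}ᶜ := by
    intro e
    induction e with | _ u v
    rintro ⟨-, h | h⟩
    · exact ⟨u, by rintro rfl; simp [(hf u).eq_none] at h, by simp [h]⟩
    · exact ⟨v, by rintro rfl; simp [(hf v).eq_none] at h, by simp [h, Sym2.eq_swap]⟩
  have h1 := (Set.ncard_le_ncard hsub).trans (Set.ncard_image_le (Set.toFinite _))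
  have h2 := Set.ncard_add_ncard_compl {r}
  rw [Set.ncard_singleton] at h2
  rw [Nat.card_coe_set_eq]
  omega

lemma eq_of_parentGraph_eq (hf : ∀ v, RootOf f v r) (hg : ∀ v, RootOf g v r)
    (h : parentGraph f = parentGraph g) : f = g := by
  have key : ∀ {v t}, RootOf f v t → f v = g v := by
    intro v t hv
    induction hv with
    | @root t ht =>
      obtain rfl := (hf t).eq_of_eq_none ht
      rw [ht, (hg t).eq_none]
    | @step v w t hvw _ ih =>
      have hadj := parentGraph_adj_of_eq_some (fun v => ⟨r, hf v⟩) hvw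
      have hadj' := h ▸ hadj
      obtain ⟨-, h' | h'⟩ := hadj'
      · rw [hvw, h']
      · rw [h'] at ih
        exfalso
        have cyc : ∀ {x s}, RootOf f x s → ∀ y, f x = some y → f y ≠ some x := by
          intro x s hx
          induction hx with
          | root h => intro y hy; simp [h] at hy
          | step h _ ih =>
            intro y hy hyx
            rw [h, Option.some_inj] at hy
            subst hy
            exact ih _ hyx h
        exact cyc (hf v) w hvw ih
  exact funext fun v => key (hf v)

lemma exists_parentGraph_eq [Finite V] {T : SimpleGraph V} (hT : T.IsTree) (r : V) :
    ∃ f, (∀ v, RootOf f v r) ∧ parentGraph f = T := by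
  classical
  have hex : ∀ v, v ≠ r → ∃ w, T.Adj v w ∧ T.dist w r < T.dist v r := by
    intro v hv
    obtain ⟨p, hp⟩ := (hT.connected.preconnected v r).exists_walk_length_eq_dist
    cases p with
    | nil => exact absurd rfl hv
    | cons h q =>
      refine ⟨_, h, ?_⟩
      rw [← hp, SimpleGraph.Walk.length_cons]
      exact Nat.lt_succ_of_le (SimpleGraph.dist_le q)
  choose! p hp using hex
  let f : V → Option V := fun v => if v = r then none else some (p v)
  have hroot : ∀ v, RootOf f v r := by
    intro v
    induction hd : T.dist v r using Nat.strong_induction_on generalizing v with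
    | _ d ih =>
      by_cases hv : v = r
      · subst hv
        exact .root (by simp [f])
      · exact .step (w := p v) (by simp [f, hv]) (ih _ (hd ▸ (hp v hv).2) _ rfl)
  have hle : parentGraph f ≤ T := by
    rintro u v ⟨-, h | h⟩
    · by_cases hu : u = r
      · simp [f, hu] at h
      · simp only [f, hu, if_false, Option.some_inj] at h
        exact h ▸ (hp u hu).1
    · by_cases hv : v = r
      · simp [f, hv] at h
      · simp only [f, hv, if_false, Option.some_inj] at h
        exact h ▸ (hp v hv).1.symm
  exact ⟨f, hroot, le_antisymm hle
    ((SimpleGraph.isTree_iff_minimal_connected.1 hT).2 (parentGraph_connected hroot) hle)⟩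

end Graph

/-- Cayley's formula. -/
theorem SimpleGraph.ncard_isTree (V : Type*) [Fintype V] [Nonempty V] :
    {T : SimpleGraph V | T.IsTree}.ncard = Fintype.card V ^ (Fintype.card V - 2) := by
  classical
  obtain ⟨N, hN⟩ := Nat.exists_eq_succ_of_ne_zero (Fintype.card_ne_zero (α := V))
  have ha : (rootedForests V 1).card = (N + 1) ^ N := by
    simpa using card_rootedForests hN le_rfl
  have hroot : ∀ f ∈ rootedForests V 1, ∃ r, ∀ v, RootOf f v r := by
    intro f hf
    obtain ⟨hf, h1⟩ := mem_rootedForests.1 hf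
    obtain ⟨r, hr⟩ := Finset.card_eq_one.1 h1
    refine ⟨r, fun v => ?_⟩
    obtain ⟨s, hs⟩ := hf v
    have : s ∈ ({r} : Finset V) := hr ▸ by simp [hs.eq_none]
    rwa [Finset.mem_singleton.1 this] at hs
  choose! ρ hρ using hroot
  have hbij : (rootedForests V 1).card =
      ({T : SimpleGraph V | T.IsTree}.toFinset ×ˢ (Finset.univ : Finset V)).card := by
    refine Finset.card_bij (fun f _ => (parentGraph f, ρ f)) ?_ ?_ ?_
    · intro f hf
      simpa using parentGraph_isTree (hρ f hf)
    · intro f hf g hg h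
      obtain ⟨h, h'⟩ := Prod.mk.inj h
      exact eq_of_parentGraph_eq (hρ f hf) (h' ▸ hρ g hg) h
    · rintro ⟨T, r⟩ hT
      obtain ⟨f, hf, rfl⟩ := exists_parentGraph_eq (T := T) (by simpa using hT) r
      have hmem : f ∈ rootedForests V 1 := by
        refine mem_rootedForests.2 ⟨fun v => ⟨r, hf v⟩, Finset.card_eq_one.2 ⟨r, ?_⟩⟩
        ext v
        simp only [Finset.mem_filter, Finset.mem_univ, true_and, Finset.mem_singleton]
        exact ⟨(hf v).eq_of_eq_none, by rintro rfl; exact (hf v).eq_none⟩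
      exact ⟨f, hmem, by rw [(hρ f hmem r).unique (hf r)]⟩
  rw [ha, Finset.card_product, ← Set.ncard_eq_toFinset_card', Finset.card_univ, hN] at hbij
  rw [hN]
  refine Nat.eq_of_mul_eq_mul_right N.succ_pos (hbij.symm.trans ?_)
  cases N with
  | zero => rfl
  | succ N => rw [Nat.succ_eq_add_one, pow_succ]; rfl

namespace SimpleGraph

variable {V : Type*} {G : SimpleGraph V} {s : Set V}

lemma Walk.mem_iff_of_forall_adj (h : ∀ u v, G.Adj u v → (u ∈ s ↔ v ∈ s)) {u v : V}
    (p : G.Walk u v) : ∀ x ∈ p.support, x ∈ s ↔ u ∈ s := by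
  induction p with
  | nil => simp
  | @cons a b c hab q ih =>
    intro x hx
    rw [Walk.support_cons, List.mem_cons] at hx
    obtain rfl | hx := hx
    · rfl
    · rw [ih x hx, h a b hab]

lemma isAcyclic_of_induce (h : ∀ u v, G.Adj u v → (u ∈ s ↔ v ∈ s))
    (hs : (G.induce s).IsAcyclic) (hsc : (G.induce sᶜ).IsAcyclic) : G.IsAcyclic := by
  have key : ∀ (t : Set V), (G.induce t).IsAcyclic → ∀ {v : V} (p : G.Walk v v),
      (∀ x ∈ p.support, x ∈ t) → ¬ p.IsCycle := by
    intro t ht v p hp hc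
    refine ht (p.induce t hp) (Walk.IsCycle.of_map (f := (Embedding.induce t).toHom) ?_)
    rwa [Walk.map_induce]
  intro v p
  by_cases hv : v ∈ s
  · exact key s hs p fun x hx => (p.mem_iff_of_forall_adj h x hx).2 hv
  · exact key sᶜ hsc p fun x hx hxs => hv ((p.mem_iff_of_forall_adj h x hx).1 hxs)

lemma exists_supp_eq_of_induce_connected (h : ∀ u v, G.Adj u v → (u ∈ s ↔ v ∈ s))
    (hs : (G.induce s).Connected) : ∃ c : G.ConnectedComponent, c.supp = s := by
  obtain ⟨⟨v, hv⟩⟩ := hs.nonempty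
  refine ⟨G.connectedComponentMk v, Set.ext fun x => ?_⟩
  rw [ConnectedComponent.mem_supp_iff, ConnectedComponent.eq]
  constructor
  · rintro ⟨p⟩
    exact (p.mem_iff_of_forall_adj h v p.end_mem_support).1 hv
  · intro hx
    exact (hs.preconnected ⟨x, hx⟩ ⟨v, hv⟩).map (Embedding.induce s).toHom

/-- The disjoint union of a graph on `s` and a graph on the complement of `s`. -/
def glue (s : Set V) (p : SimpleGraph s × SimpleGraph ↥sᶜ) : SimpleGraph V :=
  p.1.spanningCoe ⊔ p.2.spanningCoe

variable {p : SimpleGraph s × SimpleGraph ↥sᶜ}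

lemma glue_mem_iff_of_adj {u v : V} (h : (glue s p).Adj u v) : u ∈ s ↔ v ∈ s := by
  simp only [glue, sup_adj, map_adj] at h
  obtain ⟨u, v, -, rfl, rfl⟩ | ⟨u, v, -, rfl, rfl⟩ := h
  · exact iff_of_true u.2 v.2
  · exact iff_of_false u.2 v.2

lemma glue_induce : (glue s p).induce s = p.1 := by
  ext u v
  simp [glue]

lemma glue_induce_compl : (glue s p).induce sᶜ = p.2 := by
  ext u v
  have hu : ↑u ∉ s := u.2
  have hv : ↑v ∉ s := v.2
  simp [glue, hu, hv]

lemma glue_injective : Function.Injective (glue s) := fun p q h =>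
  Prod.ext (by rw [← glue_induce (p := p), h, glue_induce])
    (by rw [← glue_induce_compl (p := p), h, glue_induce_compl])

lemma glue_induce_induce (h : ∀ u v, G.Adj u v → (u ∈ s ↔ v ∈ s)) :
    glue s (G.induce s, G.induce sᶜ) = G := by
  ext u v
  have := h u v
  simp only [glue, sup_adj, map_adj, comap_adj]
  constructor
  · rintro (⟨u, v, h, rfl, rfl⟩ | ⟨u, v, h, rfl, rfl⟩) <;> exact h
  · intro huv
    by_cases hu : u ∈ s
    · exact .inl ⟨⟨u, hu⟩, ⟨v, (this huv).1 hu⟩, huv, rfl, rfl⟩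
    · exact .inr ⟨⟨u, hu⟩, ⟨v, fun hv => hu ((this huv).2 hv)⟩, huv, rfl, rfl⟩

lemma image_glue (s : Set V) :
    glue s '' ({T | T.IsTree} ×ˢ {H | H.IsAcyclic}) =
      {G | G.IsAcyclic ∧ ∃ c : G.ConnectedComponent, c.supp = s} := by
  ext G
  constructor
  · rintro ⟨p, ⟨hT, hH⟩, rfl⟩
    have hadj : ∀ u v, (glue s p).Adj u v → (u ∈ s ↔ v ∈ s) := fun _ _ => glue_mem_iff_of_adj
    refine ⟨isAcyclic_of_induce hadj ?_ ?_, exists_supp_eq_of_induce_connected hadj ?_⟩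
    · rw [glue_induce]; exact hT.isAcyclic
    · rw [glue_induce_compl]; exact hH
    · rw [glue_induce]; exact hT.connected
  · rintro ⟨hG, c, rfl⟩
    exact ⟨(G.induce c.supp, G.induce c.suppᶜ),
      ⟨hG.isTree_connectedComponent c, hG.induce _⟩,
      glue_induce_induce fun u v h => c.mem_supp_congr_adj h⟩

lemma ncard_isAcyclic_congr {W : Type*} (e : V ≃ W) :
    {G : SimpleGraph V | G.IsAcyclic}.ncard = {G : SimpleGraph W | G.IsAcyclic}.ncard := by
  rw [← Set.ncard_image_of_injective _ e.simpleGraph.injective]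
  congr 1
  ext G
  rw [← e.simpleGraph.apply_symm_apply G, e.simpleGraph.injective.mem_set_image]
  exact (Iso.comap e.symm _).isAcyclic_iff.symm

end SimpleGraph

lemma ncard_isAcyclic_supp_eq {n : ℕ} {s : Finset (Fin n)} (hs : s.Nonempty) :
    {F : SimpleGraph (Fin n) | F.IsAcyclic ∧ ∃ c : F.ConnectedComponent, c.supp = s}.ncard =
      s.card ^ (s.card - 2) * forestCount (n - s.card) := by
  have : Nonempty (s : Set (Fin n)) := hs.to_subtype
  rw [← SimpleGraph.image_glue, Set.ncard_image_of_injective _ SimpleGraph.glue_injective,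
    Set.ncard_prod, SimpleGraph.ncard_isTree, forestCount]
  have hcard : Nat.card ↥((s : Set (Fin n))ᶜ) = n - s.card := by
    rw [Nat.card_coe_set_eq, ← Finset.coe_compl, Set.ncard_coe_finset, Finset.card_compl,
      Fintype.card_fin]
  rw [SimpleGraph.ncard_isAcyclic_congr (Finite.equivFinOfCardEq hcard)]
  simp

lemma bddAbove_card_supp {n : ℕ} (F : SimpleGraph (Fin n)) :
    BddAbove {m : ℕ | ∃ c : F.ConnectedComponent, m = Nat.card c.supp} := by
  refine ⟨n, ?_⟩
  rintro _ ⟨c, rfl⟩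
  simpa using Set.ncard_le_card c.supp

lemma eq_of_lt_card_supp_add_card_supp {n : ℕ} {F : SimpleGraph (Fin n)} {c d : F.ConnectedComponent}
    (h : n < Nat.card c.supp + Nat.card d.supp) : c = d := by
  by_contra hcd
  have hdisj : Disjoint c.supp d.supp := Set.disjoint_left.2 fun v hc hd =>
    hcd (SimpleGraph.ConnectedComponent.eq_of_common_vertex hc hd)
  have h1 := Set.ncard_union_eq hdisj
  have h2 := Set.ncard_le_card (c.supp ∪ d.supp)
  rw [Nat.card_eq_fintype_card, Fintype.card_fin] at h2
  rw [Nat.card_coe_set_eq, Nat.card_coe_set_eq] at h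
  omega

lemma frag_eq_iff {n j : ℕ} (h1 : 1 ≤ j) (h2 : 2 * j < n) (F : SimpleGraph (Fin n)) :
    frag F = j ↔ ∃ c : F.ConnectedComponent, Nat.card c.supp = n - j := by
  have hne : {m : ℕ | ∃ c : F.ConnectedComponent, m = Nat.card c.supp}.Nonempty :=
    ⟨_, F.connectedComponentMk ⟨0, by omega⟩, rfl⟩
  obtain ⟨d, hd⟩ := Nat.sSup_mem hne (bddAbove_card_supp F)
  change maxCompSize F = _ at hd
  rw [frag]
  constructor
  · intro h
    exact ⟨d, by omega⟩
  · rintro ⟨c, hc⟩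
    have hle : Nat.card c.supp ≤ maxCompSize F := le_csSup (bddAbove_card_supp F) ⟨c, rfl⟩
    have hcd : c = d := eq_of_lt_card_supp_add_card_supp (by omega)
    subst hcd
    omega

theorem count_forests_with_frag (n j : ℕ) (h1 : 1 ≤ j) (h2 : 2 * j < n) :
    {F : SimpleGraph (Fin n) | F.IsAcyclic ∧ frag F = j}.ncard
      = Nat.choose n j * forestCount j * (n - j) ^ (n - j - 2) := by
  classical
  have hunion : {F : SimpleGraph (Fin n) | F.IsAcyclic ∧ frag F = j}.toFinset =
      (Finset.powersetCard (n - j) Finset.univ).biUnion fun s : Finset (Fin n) =>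
        {F : SimpleGraph (Fin n) |
          F.IsAcyclic ∧ ∃ c : F.ConnectedComponent, c.supp = s}.toFinset := by
    ext F
    simp only [Set.mem_toFinset, Set.mem_ofPred_eq, Finset.mem_biUnion, Finset.mem_powersetCard,
      Finset.subset_univ, true_and, frag_eq_iff h1 h2]
    constructor
    · rintro ⟨hF, c, hc⟩
      refine ⟨c.supp.toFinset, ?_, hF, c, by simp⟩
      rw [← hc, Nat.card_coe_set_eq, Set.ncard_eq_toFinset_card']
    · rintro ⟨s, hs, hF, c, hc⟩
      exact ⟨hF, c, by rw [hc, Nat.card_coe_set_eq, Set.ncard_coe_finset, hs]⟩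
  rw [Set.ncard_eq_toFinset_card', hunion, Finset.card_biUnion]
  · rw [Finset.sum_const_nat (m := (n - j) ^ (n - j - 2) * forestCount j)]
    · rw [Finset.card_powersetCard, Finset.card_univ, Fintype.card_fin,
        Nat.choose_symm (by omega : j ≤ n)]
      ring
    · intro s hs
      have hs := (Finset.mem_powersetCard.1 hs).2
      rw [← Set.ncard_eq_toFinset_card',
        ncard_isAcyclic_supp_eq (Finset.card_pos.1 (by omega)), hs,
        show n - (n - j) = j by omega]
  · intro s hs t ht hst
    refine Finset.disjoint_left.2 fun F hF hF' => ?_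
    obtain ⟨-, c, hc⟩ := Set.mem_toFinset.1 hF
    obtain ⟨-, d, hd⟩ := Set.mem_toFinset.1 hF'
    have hs := (Finset.mem_powersetCard.1 hs).2
    have ht := (Finset.mem_powersetCard.1 ht).2
    have hcd : c = d := eq_of_lt_card_supp_add_card_supp (by
      rw [hc, hd, Nat.card_coe_set_eq, Nat.card_coe_set_eq, Set.ncard_coe_finset,
        Set.ncard_coe_finset]
      omega)
    subst hcd
    exact hst (Finset.coe_injective (hc.symm.trans hd))
end
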